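/- arXiv:2510.05499 — 8 statements merged into one kernel-verified Lean document; each statement's English description precedes it below -/
import Mathlib

section
/- Let B be a Banach space and f : B → B a C¹ diffeomorphism satisfying a generalized (C,λ)-structure with constants C > 0 and λ ∈ (0,1). Let h : B → B be a C¹ diffeomorphism such that for some R₁ > 0, ‖Dh(x)‖ ≤ R₁ and ‖Dh⁻¹(x)‖ ≤ R₁ for all x ∈ B. Then the conjugated diffeomorphism g = h ∘ f ∘ h⁻¹ also satisfies a generalized (C',λ)-structure; explicitly, the subspaces Ẽˢ_x = Dh(h⁻¹(x))Eˢ_{h⁻¹(x)} and Ẽᵘ_x = Dh(h⁻¹(x))Eᵘ_{h⁻¹(x)} satisfy the conditions of a generalized (C,λ)-structure for g with constants C' = R₁²C and the same λ. -/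
open Set Filter

noncomputable section

variable {B : Type*} [NormedAddCommGroup B] [NormedSpace ℝ B] [CompleteSpace B]

/-- Iterated differential of `f` along the forward orbit of `x`:
`orbitDeriv f Df n x = Df(f^{n-1} x) ∘ ⋯ ∘ Df(x)`. -/
def orbitDeriv (f : B → B) (Df : B → B →L[ℝ] B) : ℕ → B → B →L[ℝ] B
  | 0, _ => ContinuousLinearMap.id ℝ B
  | (n + 1), x => orbitDeriv f Df n (f x) ∘L Df x

/-- `f` is a `C¹` diffeomorphism with inverse `fInv`, derivative `Df` and
derivative of the inverse `DfInv`. -/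
def IsC1Diffeo (f fInv : B → B) (Df DfInv : B → B →L[ℝ] B) : Prop :=
  Function.LeftInverse fInv f ∧ Function.RightInverse fInv f ∧
  (∀ x, HasFDerivAt f (Df x) x) ∧ (∀ x, HasFDerivAt fInv (DfInv x) x)

/-- The `C¹` regularity conditions (uniform continuity and boundedness of `Df`). -/
def C1Reg (f : B → B) (Df DfInv : B → B →L[ℝ] B) (R : ℝ) (r : ℝ → ℝ) : Prop :=
  0 < R ∧ MonotoneOn r (Set.Ici 0) ∧ (∀ z, 0 ≤ z → 0 ≤ r z) ∧
  Filter.Tendsto r (nhdsWithin 0 (Set.Ioi 0)) (nhds 0) ∧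
  (∀ x v : B, ‖f (x + v) - f x - Df x v‖ ≤ ‖v‖ * r ‖v‖) ∧
  (∀ x : B, ‖Df x‖ ≤ R) ∧ (∀ x : B, ‖DfInv x‖ ≤ R) ∧
  (∀ x v : B, ‖Df (x + v) - Df x‖ ≤ r ‖v‖)

/-- Generalized `(C, λ)`-structure for a diffeomorphism `f`, with stable/unstable
projections `P x`, `Q x` (no continuity in `x` assumed). -/
def IsGenCL (f fInv : B → B) (Df DfInv : B → B →L[ℝ] B)
    (C lam : ℝ) (P Q : B → B →L[ℝ] B) : Prop :=
  (∀ x, P x + Q x = ContinuousLinearMap.id ℝ B) ∧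
  (∀ x, ‖P x‖ ≤ C) ∧ (∀ x, ‖Q x‖ ≤ C) ∧
  (∀ x, Set.MapsTo (Df x) (Set.range (P x)) (Set.range (P (f x)))) ∧
  (∀ x, Set.MapsTo (DfInv x) (Set.range (Q x)) (Set.range (Q (fInv x)))) ∧
  (∀ x (n : ℕ) (v : B), v ∈ Set.range (P x) →
      ‖orbitDeriv f Df n x v‖ ≤ C * lam ^ n * ‖v‖) ∧
  (∀ x (n : ℕ) (v : B), v ∈ Set.range (Q x) →
      ‖orbitDeriv fInv DfInv n x v‖ ≤ C * lam ^ n * ‖v‖)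

/-- For an interval `I ⊆ ℤ`, `tildeI I = {k : k ∈ I and k+1 ∈ I}`. -/
def tildeI (I : Set ℤ) : Set ℤ := {k | k ∈ I ∧ k + 1 ∈ I}

/-- Bounded solution property on `I` with constant `L`. -/
def BSP (I : Set ℤ) (A : ℤ → B →L[ℝ] B) (L : ℝ) : Prop :=
  ∀ w : ℤ → B, (∀ k ∈ tildeI I, ‖w (k + 1)‖ ≤ 1) →
    ∃ v : ℤ → B, (∀ k ∈ I, ‖v k‖ ≤ L) ∧ ∀ k ∈ tildeI I, v (k + 1) = A k (v k) + w (k + 1)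

/-- Strong bounded solution property on `I` with constant `L`: the difference
operator `T_A : ℓ^∞(I,B) → ℓ^∞(Ĩ,B)` has a bounded linear right inverse of norm `≤ L`. -/
def StrongBSP (I : Set ℤ) (A : ℤ → B →L[ℝ] B) (L : ℝ) : Prop :=
  ∃ S : BoundedContinuousFunction ℤ B →L[ℝ] BoundedContinuousFunction ℤ B,
    (∀ (w : BoundedContinuousFunction ℤ B) (M : ℝ),
        (∀ k ∈ tildeI I, ‖w (k + 1)‖ ≤ M) → ∀ k ∈ I, ‖S w k‖ ≤ L * M) ∧
    (∀ w : BoundedContinuousFunction ℤ B, ∀ k ∈ tildeI I,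
        S w (k + 1) = A k (S w k) + w (k + 1))

omit [CompleteSpace B] in
theorem IsC1Diffeo.deriv_derivInv {h hInv : B → B} {Dh DhInv : B → B →L[ℝ] B}
    (hh : IsC1Diffeo h hInv Dh DhInv) (x v : B) : Dh (hInv x) (DhInv x v) = v := by
  obtain ⟨-, hr, hd, hdInv⟩ := hh
  have key : HasFDerivAt (h ∘ hInv) (Dh (hInv x) ∘L DhInv x) x := (hd (hInv x)).comp x (hdInv x)
  rw [hr.comp_eq_id] at key
  exact congrArg (fun T : B →L[ℝ] B => T v) (key.unique (hasFDerivAt_id x))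

omit [CompleteSpace B] in
theorem IsC1Diffeo.symm {h hInv : B → B} {Dh DhInv : B → B →L[ℝ] B}
    (hh : IsC1Diffeo h hInv Dh DhInv) : IsC1Diffeo hInv h DhInv Dh :=
  ⟨hh.2.1, hh.1, hh.2.2.2, hh.2.2.1⟩

omit [CompleteSpace B] in
theorem IsC1Diffeo.derivInv_deriv {h hInv : B → B} {Dh DhInv : B → B →L[ℝ] B}
    (hh : IsC1Diffeo h hInv Dh DhInv) (x v : B) : DhInv (h x) (Dh x v) = v :=
  hh.symm.deriv_derivInv x v

omit [CompleteSpace B] in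
theorem IsC1Diffeo.range_conj {h hInv : B → B} {Dh DhInv : B → B →L[ℝ] B}
    (hh : IsC1Diffeo h hInv Dh DhInv) (T : B →L[ℝ] B) (x : B) :
    Set.range ((Dh (hInv x) ∘L T) ∘L DhInv x) = Dh (hInv x) '' Set.range T := by
  have hsurj : Function.Surjective (DhInv x) := fun v =>
    ⟨Dh (hInv x) v, by simpa only [hh.2.1 x] using hh.derivInv_deriv (hInv x) v⟩
  rw [← Set.range_comp, ← hsurj.range_comp (Dh (hInv x) ∘ T)]
  rfl

omit [CompleteSpace B] in
theorem norm_conj_le {S T U : B →L[ℝ] B} {R C : ℝ} (hS : ‖S‖ ≤ R) (hT : ‖T‖ ≤ C)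
    (hU : ‖U‖ ≤ R) : ‖(S ∘L T) ∘L U‖ ≤ R ^ 2 * C := by
  have hR : 0 ≤ R := (norm_nonneg S).trans hS
  have hC : 0 ≤ C := (norm_nonneg T).trans hT
  calc ‖(S ∘L T) ∘L U‖ ≤ ‖S‖ * ‖T‖ * ‖U‖ :=
        (ContinuousLinearMap.opNorm_comp_le _ _).trans <| by
          gcongr
          exact ContinuousLinearMap.opNorm_comp_le _ _
    _ ≤ R * C * R := by gcongr
    _ = R ^ 2 * C := by ring

omit [CompleteSpace B] in
theorem IsC1Diffeo.mapsTo_conj {h hInv f : B → B} {Dh DhInv Df P : B → B →L[ℝ] B}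
    (hh : IsC1Diffeo h hInv Dh DhInv)
    (hP : ∀ x, Set.MapsTo (Df x) (Set.range (P x)) (Set.range (P (f x)))) (x : B) :
    Set.MapsTo ((Dh (f (hInv x)) ∘L Df (hInv x)) ∘L DhInv x)
      (Set.range ((Dh (hInv x) ∘L P (hInv x)) ∘L DhInv x))
      (Set.range ((Dh (hInv (h (f (hInv x)))) ∘L P (hInv (h (f (hInv x))))) ∘L
        DhInv (h (f (hInv x))))) := by
  rw [hh.range_conj, hh.range_conj, hh.1]
  rintro _ ⟨w, hw, rfl⟩
  refine ⟨Df (hInv x) w, hP _ hw, ?_⟩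
  have := hh.derivInv_deriv (hInv x) w
  rw [hh.2.1] at this
  simp [this]

omit [CompleteSpace B] in
theorem IsC1Diffeo.orbitDeriv_conj {h hInv : B → B} {Dh DhInv : B → B →L[ℝ] B}
    (hh : IsC1Diffeo h hInv Dh DhInv) (f : B → B) (Df : B → B →L[ℝ] B) (n : ℕ) (x v : B) :
    orbitDeriv (fun x => h (f (hInv x)))
        (fun x => (Dh (f (hInv x)) ∘L Df (hInv x)) ∘L DhInv x) n x v
      = Dh (f^[n] (hInv x)) (orbitDeriv f Df n (hInv x) (DhInv x v)) := by
  induction n generalizing x v with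
  | zero => simp [orbitDeriv, hh.deriv_derivInv]
  | succ n ih =>
    simp only [orbitDeriv, ContinuousLinearMap.comp_apply, ih, hh.derivInv_deriv,
      Function.iterate_succ_apply, hh.1 (f (hInv x))]

omit [CompleteSpace B] in
theorem IsC1Diffeo.norm_orbitDeriv_conj_le {h hInv f : B → B} {Dh DhInv Df P : B → B →L[ℝ] B}
    {C lam R : ℝ} (hh : IsC1Diffeo h hInv Dh DhInv) (hC : 0 ≤ C) (hlam : 0 ≤ lam)
    (hDh : ∀ x, ‖Dh x‖ ≤ R) (hDhInv : ∀ x, ‖DhInv x‖ ≤ R)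
    (hP : ∀ x (n : ℕ) (v : B), v ∈ Set.range (P x) →
      ‖orbitDeriv f Df n x v‖ ≤ C * lam ^ n * ‖v‖)
    (x : B) (n : ℕ) (v : B) (hv : v ∈ Set.range ((Dh (hInv x) ∘L P (hInv x)) ∘L DhInv x)) :
    ‖orbitDeriv (fun x => h (f (hInv x)))
        (fun x => (Dh (f (hInv x)) ∘L Df (hInv x)) ∘L DhInv x) n x v‖
      ≤ R ^ 2 * C * lam ^ n * ‖v‖ := by
  have hR : 0 ≤ R := (norm_nonneg _).trans (hDh x)
  have hmem : DhInv x v ∈ Set.range (P (hInv x)) := by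
    rw [hh.range_conj] at hv
    obtain ⟨w, hw, rfl⟩ := hv
    have := hh.derivInv_deriv (hInv x) w
    rw [hh.2.1] at this
    rwa [this]
  rw [hh.orbitDeriv_conj]
  calc _ ≤ R * ‖orbitDeriv f Df n (hInv x) (DhInv x v)‖ :=
        (Dh _).le_of_opNorm_le (hDh _) _
    _ ≤ R * (C * lam ^ n * ‖DhInv x v‖) := by gcongr; exact hP _ _ _ hmem
    _ ≤ R * (C * lam ^ n * (R * ‖v‖)) := by
        gcongr
        exact (DhInv x).le_of_opNorm_le (hDhInv x) v
    _ = R ^ 2 * C * lam ^ n * ‖v‖ := by ring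

/-- A generalized `(C, λ)`-structure is preserved under conjugation by a
diffeomorphism `h` with uniformly bounded differentials: `g = h ∘ f ∘ h⁻¹` satisfies a
generalized `(R₁² C, λ)`-structure with subspaces `Ẽˢ_x = Dh(h⁻¹ x) Eˢ_{h⁻¹ x}`,
`Ẽᵘ_x = Dh(h⁻¹ x) Eᵘ_{h⁻¹ x}`. -/
theorem statement0
    {B : Type*} [NormedAddCommGroup B] [NormedSpace ℝ B] [CompleteSpace B]
    (f fInv : B → B) (Df DfInv : B → B →L[ℝ] B)
    (h hInv : B → B) (Dh DhInv : B → B →L[ℝ] B)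
    (C lam R₁ : ℝ) (hC : 0 < C) (hlam : lam ∈ Set.Ioo (0 : ℝ) 1) (hR₁ : 0 < R₁)
    (hf : IsC1Diffeo f fInv Df DfInv) (hh : IsC1Diffeo h hInv Dh DhInv)
    (hDh : ∀ x, ‖Dh x‖ ≤ R₁) (hDhInv : ∀ x, ‖DhInv x‖ ≤ R₁)
    (P Q : B → B →L[ℝ] B) (hCL : IsGenCL f fInv Df DfInv C lam P Q) :
    IsGenCL (fun x => h (f (hInv x))) (fun x => h (fInv (hInv x)))
      (fun x => (Dh (f (hInv x)) ∘L Df (hInv x)) ∘L DhInv x)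
      (fun x => (Dh (fInv (hInv x)) ∘L DfInv (hInv x)) ∘L DhInv x)
      (R₁ ^ 2 * C) lam
      (fun x => (Dh (hInv x) ∘L P (hInv x)) ∘L DhInv x)
      (fun x => (Dh (hInv x) ∘L Q (hInv x)) ∘L DhInv x) ∧
    (∀ x, Set.range ((Dh (hInv x) ∘L P (hInv x)) ∘L DhInv x)
        = Dh (hInv x) '' Set.range (P (hInv x))) ∧
    (∀ x, Set.range ((Dh (hInv x) ∘L Q (hInv x)) ∘L DhInv x)
        = Dh (hInv x) '' Set.range (Q (hInv x))) := by
  obtain ⟨hPQ, hPn, hQn, hPm, hQm, hPo, hQo⟩ := hCL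
  refine ⟨⟨fun x => ?_, fun x => norm_conj_le (hDh _) (hPn _) (hDhInv x),
    fun x => norm_conj_le (hDh _) (hQn _) (hDhInv x), hh.mapsTo_conj hPm, hh.mapsTo_conj hQm,
    hh.norm_orbitDeriv_conj_le hC.le hlam.1.le hDh hDhInv hPo,
    hh.norm_orbitDeriv_conj_le hC.le hlam.1.le hDh hDhInv hQo⟩,
    fun x => hh.range_conj _ x, fun x => hh.range_conj _ x⟩
  ext v
  rw [← ContinuousLinearMap.add_comp, ← ContinuousLinearMap.comp_add, hPQ]
  exact hh.deriv_derivInv x v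

end
end

section
/- Let B be a Banach space and L > 0. Then there exists ε > 0 (any ε < 1/(2L) works) such that the following holds: for any interval I ⊆ ℤ (finite or infinite) and any sequence A = {A_k}_{k∈I} of bounded linear isomorphisms of B satisfying the strong bounded solution property on I with constant L, every sequence B = {B_k}_{k∈I} of bounded linear operators on B with ‖B_k − A_k‖ ≤ ε for all k ∈ I satisfies the bounded solution property on I with constant 2L. -/
open Set Filter

noncomputable section

variable {B : Type*} [NormedAddCommGroup B] [NormedSpace ℝ B] [CompleteSpace B]

/-- Robustness of the (strong) bounded solution property: for every
`L > 0` there is `ε > 0` such that whenever a sequence of isomorphisms `A` satisfies the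
strong bounded solution property on an interval `I` with constant `L`, every sequence of
bounded operators `Bk` with `‖Bk k − A k‖ ≤ ε` on `I` satisfies the bounded solution
property on `I` with constant `2L`. -/
theorem statement2
    {B : Type*} [NormedAddCommGroup B] [NormedSpace ℝ B] [CompleteSpace B]
    (L : ℝ) (hL : 0 < L) :
    ∃ ε : ℝ, 0 < ε ∧
      ∀ (I : Set ℤ), I.OrdConnected →
        ∀ A : ℤ → B ≃L[ℝ] B,
          StrongBSP I (fun k => (A k : B →L[ℝ] B)) L →
          ∀ Bk : ℤ → B →L[ℝ] B,
            (∀ k ∈ I, ‖Bk k - (A k : B →L[ℝ] B)‖ ≤ ε) →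
            BSP I Bk (2 * L) := by
  refine ⟨1 / (2 * L), by positivity, fun I _ A hA Bk hBk w hw => ?_⟩
  obtain ⟨S, hS, hSA⟩ := hA
  have hpert : ∀ (z : BoundedContinuousFunction ℤ B), ∀ k ∈ tildeI I,
      ‖(Bk k - (A k : B →L[ℝ] B)) (S z k)‖ ≤ 1 / 2 * ‖z‖ := by
    intro z k hk
    calc ‖(Bk k - (A k : B →L[ℝ] B)) (S z k)‖
        ≤ ‖Bk k - (A k : B →L[ℝ] B)‖ * ‖S z k‖ := ContinuousLinearMap.le_opNorm _ _
      _ ≤ 1 / (2 * L) * (L * ‖z‖) :=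
          mul_le_mul (hBk k hk.1) (hS z ‖z‖ (fun k _ => z.norm_coe_le_norm _) k hk.1)
            (norm_nonneg _) (by positivity)
      _ = 1 / 2 * ‖z‖ := by field_simp
  classical
  let g (z : BoundedContinuousFunction ℤ B) (j : ℤ) : B :=
    if j - 1 ∈ tildeI I then
      w j + (Bk (j - 1) - (A (j - 1) : B →L[ℝ] B)) (S z (j - 1)) else 0
  have hg : ∀ z j, ‖g z j‖ ≤ 1 + 1 / 2 * ‖z‖ := by
    intro z j
    by_cases hj : j - 1 ∈ tildeI I
    · have hwj : ‖w j‖ ≤ 1 := by simpa using hw _ hj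
      simp only [g, if_pos hj]
      exact (norm_add_le _ _).trans (add_le_add hwj (hpert z _ hj))
    · simp only [g, if_neg hj, norm_zero]
      positivity
  let G (z : BoundedContinuousFunction ℤ B) : BoundedContinuousFunction ℤ B :=
    BoundedContinuousFunction.ofNormedAddCommGroupDiscrete (g z) _ (hg z)
  have hG : ContractingWith (1 / 2) G := by
    refine ⟨by rw [div_lt_one] <;> norm_num, LipschitzWith.of_dist_le_mul fun z z' => ?_⟩
    refine (BoundedContinuousFunction.dist_le (by positivity)).2 fun j => ?_
    change dist (g z j) (g z' j) ≤ _
    by_cases hj : j - 1 ∈ tildeI I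
    · have h := hpert (z - z') _ hj
      rw [map_sub S, BoundedContinuousFunction.sub_apply, map_sub (Bk _ - _)] at h
      simp only [g, if_pos hj, dist_add_left]
      simpa only [dist_eq_norm, NNReal.coe_div, NNReal.coe_one, NNReal.coe_ofNat] using h
    · simp only [g, if_neg hj, dist_self]
      positivity
  obtain ⟨z, hz, -⟩ := hG.exists_fixedPoint 0 (edist_ne_top _ _)
  have hzg : ∀ j, z j = g z j := fun j => (DFunLike.congr_fun hz j).symm
  have hz2 : ‖z‖ ≤ 2 := by
    have h : ‖z‖ ≤ 1 + 1 / 2 * ‖z‖ :=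
      (BoundedContinuousFunction.norm_le (by positivity)).2 fun j => hzg j ▸ hg z j
    linarith
  refine ⟨S z, fun k hk => ?_, fun k hk => ?_⟩
  · rw [mul_comm]
    exact hS z 2 (fun k _ => (z.norm_coe_le_norm _).trans hz2) k hk
  · rw [hSA z k hk, hzg]
    simp only [g, add_sub_cancel_right, if_pos hk, sub_apply]
    abel

end
end

section
/- Let B be a reflexive Banach space and {B_k : B → B}_{k∈ℤ} a sequence of bounded linear operators. Assume that there exists L > 0 such that for every finite interval I = (a,b) ⊂ ℤ the finite sequence {B_k}_{k∈I} satisfies the bounded solution property on I with constant L. Then the full sequence {B_k}_{k∈ℤ} satisfies the bounded solution property on ℤ with constant L: for every sequence {w_k}_{k∈ℤ} ⊂ B with |w_k| ≤ 1 there exists {v_k}_{k∈ℤ} ⊂ B with |v_k| ≤ L and v_{k+1} = B_k v_k + w_{k+1} for all k ∈ ℤ. -/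
open Set Filter

noncomputable section

variable {B : Type*} [NormedAddCommGroup B] [NormedSpace ℝ B] [CompleteSpace B]

/-- In a reflexive space, a sequence that is eventually bounded along an ultrafilter converges
weakly along that ultrafilter, with the same bound for the limit. -/
theorem exists_weak_limit_of_reflexive
    {ι E : Type*} [NormedAddCommGroup E] [NormedSpace ℝ E]
    (hrefl : Function.Surjective (NormedSpace.inclusionInDoubleDual ℝ E))
    (U : Ultrafilter ι) (x : ι → E) (L : ℝ) (hx : ∀ᶠ i in (U : Filter ι), ‖x i‖ ≤ L) :
    ∃ y : E, ‖y‖ ≤ L ∧ ∀ φ : E →L[ℝ] ℝ, Tendsto (fun i => φ (x i)) U (nhds (φ y)) := by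
  let F : ι → WeakDual ℝ (StrongDual ℝ E) := fun i =>
    StrongDual.toWeakDual (NormedSpace.inclusionInDoubleDual ℝ E (x i))
  have hmem : ∀ᶠ i in (U : Filter ι), F i ∈ WeakDual.toStrongDual ⁻¹'
      Metric.closedBall (0 : StrongDual ℝ (StrongDual ℝ E)) L := by
    filter_upwards [hx] with i hi
    exact (mem_closedBall_zero_iff (E := StrongDual ℝ (StrongDual ℝ E))).2
      ((NormedSpace.double_dual_bound ℝ E (x i)).trans hi)
  obtain ⟨z, hz, hle⟩ := (WeakDual.isCompact_closedBall
    (0 : StrongDual ℝ (StrongDual ℝ E)) L).ultrafilter_le_nhds' (U.map F) hmem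
  obtain ⟨y, hy⟩ := hrefl (WeakDual.toStrongDual z)
  have hzn : ‖WeakDual.toStrongDual z‖ ≤ L := by simpa using hz
  refine ⟨y, ?_, fun φ => ?_⟩
  · rw [← (NormedSpace.inclusionInDoubleDualLi ℝ (E := E)).norm_map y]
    exact (congrArg norm hy).trans_le hzn
  · have hφ : z φ = φ y := (DFunLike.congr_fun hy φ).symm
    rw [← hφ]
    exact ((WeakDual.eval_continuous φ).tendsto z).comp hle

/-- In a reflexive Banach space, if a sequence of bounded operators
satisfies the bounded solution property with constant `L` on every finite interval
`(a, b) ⊂ ℤ`, then it satisfies the bounded solution property on all of `ℤ` with the same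
constant `L`. -/
theorem statement3
    {B : Type*} [NormedAddCommGroup B] [NormedSpace ℝ B] [CompleteSpace B]
    (hrefl : Function.Surjective (NormedSpace.inclusionInDoubleDual ℝ B))
    (Bk : ℤ → B →L[ℝ] B) (L : ℝ) (hL : 0 < L)
    (hfin : ∀ a b : ℤ, BSP (Set.Ioo a b) Bk L) :
    ∀ w : ℤ → B, (∀ k, ‖w k‖ ≤ 1) →
      ∃ v : ℤ → B, (∀ k, ‖v k‖ ≤ L) ∧ ∀ k, v (k + 1) = Bk k (v k) + w (k + 1) := by
  intro w hw
  choose v hvL hv using fun n : ℕ => hfin (-n) n w fun k _ => hw (k + 1)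
  have hmem : ∀ k : ℤ, ∀ᶠ n : ℕ in (hyperfilter ℕ : Filter ℕ), k ∈ Set.Ioo (-n : ℤ) n := by
    intro k
    refine Nat.hyperfilter_le_atTop ?_
    filter_upwards [eventually_gt_atTop k.natAbs] with n hn
    constructor <;> omega
  choose y hyL hy using fun k => exists_weak_limit_of_reflexive hrefl (hyperfilter ℕ)
    (fun n => v n k) L ((hmem k).mono fun n hn => hvL n k hn)
  refine ⟨y, hyL, fun k => (SeparatingDual.eq_iff_forall_dual_eq (R := ℝ)).2 fun φ => ?_⟩
  refine tendsto_nhds_unique_of_eventuallyEq (hy (k + 1) φ)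
    (((hy k (φ ∘L Bk k)).add_const (φ (w (k + 1)))).trans_eq ?_) ?_
  · simp
  · filter_upwards [hmem k, hmem (k + 1)] with n h₁ h₂
    simp [hv n k ⟨h₁, h₂⟩]

end
end

section
/- Let B be a Banach space and A = {A_k}_{k∈ℤ} an m-periodic sequence (A_{k+m} = A_k for all k) of bounded linear isomorphisms of B with ‖A_k‖, ‖A_k⁻¹‖ ≤ R, satisfying a (not necessarily periodic) generalized (C,λ)-structure with constants C > 0, λ ∈ (0,1). Then, with L = C²(1+λ)/(1−λ), for every m-periodic sequence {w_k}_{k∈ℤ} ⊂ B with |w_k| ≤ 1 there exists an m-periodic sequence {v_k}_{k∈ℤ} ⊂ B satisfying v_{k+1} = A_k v_k + w_{k+1} and |v_k| ≤ L for all k ∈ ℤ. -/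
open Set Filter

noncomputable section

variable {B : Type*} [NormedAddCommGroup B] [NormedSpace ℝ B] [CompleteSpace B]

/-- Forward product `fwd A k n = A_{k+n-1} ⋯ A_{k+1} A_k`. -/
def fwd (A : ℤ → B ≃L[ℝ] B) (k : ℤ) : ℕ → B →L[ℝ] B
  | 0 => ContinuousLinearMap.id ℝ B
  | (n + 1) => ((A (k + n) : B →L[ℝ] B)) ∘L fwd A k n

/-- Backward product `bwd A k n = A_{k-n}⁻¹ ⋯ A_{k-2}⁻¹ A_{k-1}⁻¹`. -/
def bwd (A : ℤ → B ≃L[ℝ] B) (k : ℤ) : ℕ → B →L[ℝ] B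
  | 0 => ContinuousLinearMap.id ℝ B
  | (n + 1) => (((A (k - n - 1)).symm : B →L[ℝ] B)) ∘L bwd A k n

/-- Generalized `(C, λ)`-structure for a sequence of linear isomorphisms. -/
def SeqGenCL (A : ℤ → B ≃L[ℝ] B) (C lam : ℝ) (P Q : ℤ → B →L[ℝ] B) : Prop :=
  (∀ k, P k + Q k = ContinuousLinearMap.id ℝ B) ∧
  (∀ k, ‖P k‖ ≤ C) ∧ (∀ k, ‖Q k‖ ≤ C) ∧
  (∀ k, Set.MapsTo (A k) (Set.range (P k)) (Set.range (P (k + 1)))) ∧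
  (∀ k, Set.MapsTo (A k).symm (Set.range (Q (k + 1))) (Set.range (Q k))) ∧
  (∀ (k : ℤ) (n : ℕ) (v : B), v ∈ Set.range (P k) → ‖fwd A k n v‖ ≤ C * lam ^ n * ‖v‖) ∧
  (∀ (k : ℤ) (n : ℕ) (v : B), v ∈ Set.range (Q k) → ‖bwd A k n v‖ ≤ C * lam ^ n * ‖v‖)

/-- Exponential dichotomy of a sequence of isomorphisms on an interval `I ⊆ ℤ`. -/
def EDOn (I : Set ℤ) (A : ℤ → B ≃L[ℝ] B) : Prop :=
  ∃ (C lam : ℝ) (P Q : ℤ → B →L[ℝ] B), 0 < C ∧ lam ∈ Set.Ioo (0 : ℝ) 1 ∧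
    (∀ k, P k + Q k = ContinuousLinearMap.id ℝ B) ∧
    (∀ k, ‖P k‖ ≤ C ∧ ‖Q k‖ ≤ C) ∧
    (∀ k, k ∈ I → k + 1 ∈ I →
      (A k) '' Set.range (P k) = Set.range (P (k + 1)) ∧
      (A k).symm '' Set.range (Q (k + 1)) = Set.range (Q k)) ∧
    (∀ (k : ℤ) (n : ℕ) (v : B), k ∈ I → k + (n : ℤ) ∈ I → v ∈ Set.range (P k) →
      ‖fwd A k n v‖ ≤ C * lam ^ n * ‖v‖) ∧
    (∀ (k : ℤ) (n : ℕ) (v : B), k - (n : ℤ) ∈ I → k ∈ I → v ∈ Set.range (Q k) →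
      ‖bwd A k n v‖ ≤ C * lam ^ n * ‖v‖)

/-- Forward cocycle power `A^n_α(x) = A(α^{n-1} x) ⋯ A(α x) A(x)`. -/
def cocFwd (α : B → B) (A : B → B ≃L[ℝ] B) : ℕ → B → B →L[ℝ] B
  | 0, _ => ContinuousLinearMap.id ℝ B
  | (n + 1), x => cocFwd α A n (α x) ∘L (A x : B →L[ℝ] B)

/-- Backward cocycle power `A^{-n}_α(x) = A(α^{-n} x)⁻¹ ⋯ A(α^{-1} x)⁻¹`. -/
def cocBwd (αInv : B → B) (A : B → B ≃L[ℝ] B) : ℕ → B → B →L[ℝ] B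
  | 0, _ => ContinuousLinearMap.id ℝ B
  | (n + 1), x => cocBwd αInv A n (αInv x) ∘L ((A (αInv x)).symm : B →L[ℝ] B)

/-- The cocycle `(C, λ)` property for the pair `(α, A)`. -/
def CocycleCL (α αInv : B → B) (A : B → B ≃L[ℝ] B) (C lam : ℝ)
    (P Q : B → B →L[ℝ] B) : Prop :=
  (∀ x, P x + Q x = ContinuousLinearMap.id ℝ B) ∧
  (∀ x, ‖P x‖ ≤ C) ∧ (∀ x, ‖Q x‖ ≤ C) ∧
  (∀ x, Set.MapsTo (A x) (Set.range (P x)) (Set.range (P (α x)))) ∧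
  (∀ x, Set.MapsTo (A x).symm (Set.range (Q (α x))) (Set.range (Q x))) ∧
  (∀ x (n : ℕ) (v : B), v ∈ Set.range (P x) → ‖cocFwd α A n x v‖ ≤ C * lam ^ n * ‖v‖) ∧
  (∀ x (n : ℕ) (v : B), v ∈ Set.range (Q x) → ‖cocBwd αInv A n x v‖ ≤ C * lam ^ n * ‖v‖)

section BoundedSolutions

variable {E : Type*} [NormedAddCommGroup E] [NormedSpace ℝ E]

lemma periodic_fwd {A : ℤ → E ≃L[ℝ] E} {m : ℤ} (hA : Function.Periodic A m) (n : ℕ) :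
    Function.Periodic (fun k => fwd A k n) m := by
  intro k
  induction n with
  | zero => rfl
  | succ n ih =>
    change fwd A (k + m) n = fwd A k n at ih
    simp only [fwd, ih, add_right_comm k m, hA (k + n)]

lemma periodic_bwd {A : ℤ → E ≃L[ℝ] E} {m : ℤ} (hA : Function.Periodic A m) (n : ℕ) :
    Function.Periodic (fun k => bwd A k n) m := by
  intro k
  induction n with
  | zero => rfl
  | succ n ih =>
    change bwd A (k + m) n = bwd A k n at ih
    have h : k + m - n - 1 = k - n - 1 + m := by ring
    simp only [bwd, ih, h, hA (k - n - 1)]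

/-- The candidate bounded solution of `v (k + 1) = A k (v k) + a (k + 1) + b (k + 1)` that
propagates `a` forwards and `b` backwards. -/
def greenSolution (A : ℤ → E ≃L[ℝ] E) (a b : ℤ → E) (k : ℤ) : E :=
  ∑' n : ℕ, fwd A (k - n) n (a (k - n)) -
    ∑' n : ℕ, bwd A (k + 1 + n) (n + 1) (b (k + 1 + n))

lemma periodic_greenSolution {A : ℤ → E ≃L[ℝ] E} {a b : ℤ → E} {m : ℤ}
    (hA : Function.Periodic A m) (ha : Function.Periodic a m) (hb : Function.Periodic b m) :
    Function.Periodic (greenSolution A a b) m := by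
  intro k
  unfold greenSolution
  congr 1
  · refine tsum_congr fun n => ?_
    rw [add_sub_right_comm, ha, show fwd A (k - n + m) n = _ from periodic_fwd hA n _]
  · refine tsum_congr fun n => ?_
    have h : k + m + 1 + n = k + 1 + n + m := by ring
    rw [h, hb, show bwd A (k + 1 + n + m) (n + 1) = _ from periodic_bwd hA (n + 1) _]

variable {A : ℤ → E ≃L[ℝ] E} {a b : ℤ → E} {K lam : ℝ}

lemma norm_greenSolution_le (h₀ : 0 ≤ lam) (h₁ : lam < 1)
    (ha : ∀ (k : ℤ) (n : ℕ), ‖fwd A k n (a k)‖ ≤ K * lam ^ n)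
    (hb : ∀ (k : ℤ) (n : ℕ), ‖bwd A k n (b k)‖ ≤ K * lam ^ n) (k : ℤ) :
    ‖greenSolution A a b k‖ ≤ K * (1 + lam) / (1 - lam) := by
  have hs := hasSum_geometric_of_lt_one h₀ h₁
  have hfwd := tsum_of_norm_bounded (hs.mul_left K) fun n : ℕ => ha (k - n) n
  have hbwd := tsum_of_norm_bounded (hs.mul_left (K * lam)) fun n : ℕ =>
    (hb (k + 1 + n) (n + 1)).trans_eq (by ring : _ = K * lam * lam ^ n)
  calc ‖greenSolution A a b k‖ ≤ K * (1 - lam)⁻¹ + K * lam * (1 - lam)⁻¹ :=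
        (norm_sub_le _ _).trans (add_le_add hfwd hbwd)
    _ = K * (1 + lam) / (1 - lam) := by ring

lemma greenSolution_add_one [CompleteSpace E] (h₀ : 0 ≤ lam) (h₁ : lam < 1)
    (ha : ∀ (k : ℤ) (n : ℕ), ‖fwd A k n (a k)‖ ≤ K * lam ^ n)
    (hb : ∀ (k : ℤ) (n : ℕ), ‖bwd A k n (b k)‖ ≤ K * lam ^ n) (k : ℤ) :
    greenSolution A a b (k + 1) =
      A k (greenSolution A a b k) + (a (k + 1) + b (k + 1)) := by
  have hs := (summable_geometric_of_lt_one h₀ h₁).mul_left K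
  have hfwd : Summable fun n : ℕ => fwd A (k + 1 - n) n (a (k + 1 - n)) :=
    .of_norm_bounded hs fun n => ha _ n
  have hbwd : Summable fun n : ℕ => bwd A (k + 1 + n) n (b (k + 1 + n)) :=
    .of_norm_bounded hs fun n => hb _ n
  have hA_fwd (n : ℕ) : A k (fwd A (k - n) n (a (k - n))) =
      fwd A (k + 1 - (n + 1 : ℕ)) (n + 1) (a (k + 1 - (n + 1 : ℕ))) := by
    simp [fwd]
  have hA_bwd (n : ℕ) : A k (bwd A (k + 1 + n) (n + 1) (b (k + 1 + n))) =
      bwd A (k + 1 + n) n (b (k + 1 + n)) := by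
    simp [bwd]
  have h_shift (n : ℕ) : k + 1 + ((n + 1 : ℕ) : ℤ) = k + 1 + 1 + n := by push_cast; ring
  unfold greenSolution
  rw [map_sub, (A k).map_tsum, (A k).map_tsum, tsum_congr hA_fwd, tsum_congr hA_bwd,
    hfwd.tsum_eq_zero_add, hbwd.tsum_eq_zero_add]
  simp only [h_shift]
  simp only [fwd, bwd, Nat.cast_zero, sub_zero, add_zero, ContinuousLinearMap.id_apply]
  abel

end BoundedSolutions

/-- Periodic bounded solutions: if an `m`-periodic sequence of
isomorphisms satisfies a (not necessarily periodic) generalized `(C, λ)`-structure, then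
with `L = C²(1+λ)/(1−λ)` every `m`-periodic sequence `{w_k}` with `‖w_k‖ ≤ 1` admits an
`m`-periodic solution `{v_k}` of `v_{k+1} = A_k v_k + w_{k+1}` with `‖v_k‖ ≤ L`. -/
theorem statement4
    {B : Type*} [NormedAddCommGroup B] [NormedSpace ℝ B] [CompleteSpace B]
    (A : ℤ → B ≃L[ℝ] B) (m : ℤ) (hm : 0 < m) (R C lam : ℝ)
    (hR : ∀ k, ‖(A k : B →L[ℝ] B)‖ ≤ R ∧ ‖((A k).symm : B →L[ℝ] B)‖ ≤ R)
    (hper : ∀ k, A (k + m) = A k)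
    (hC : 0 < C) (hlam : lam ∈ Set.Ioo (0 : ℝ) 1)
    (P Q : ℤ → B →L[ℝ] B) (hCL : SeqGenCL A C lam P Q) :
    ∀ w : ℤ → B, (∀ k, w (k + m) = w k) → (∀ k, ‖w k‖ ≤ 1) →
      ∃ v : ℤ → B, (∀ k, v (k + m) = v k) ∧
        (∀ k, ‖v k‖ ≤ C ^ 2 * (1 + lam) / (1 - lam)) ∧
        ∀ k, v (k + 1) = A k (v k) + w (k + 1) := by
  obtain ⟨hPQ, hP, hQ, -, -, hfwd, hbwd⟩ := hCL
  intro w hw hw1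
  have hmod (k : ℤ) : k + m * -(k / m) = k % m := by rw [Int.emod_def]; ring
  have hAm (k : ℤ) (n : ℕ) : fwd A (k % m) n = fwd A k n ∧ bwd A (k % m) n = bwd A k n := by
    rw [← hmod, mul_comm]
    exact ⟨(periodic_fwd hper n).int_mul _ k, (periodic_bwd hper n).int_mul _ k⟩
  have hmap {T : B →L[ℝ] B} (hT : ‖T‖ ≤ C) (k : ℤ) : ‖T (w k)‖ ≤ C := by
    simpa using T.le_of_opNorm_le_of_le hT (hw1 k)
  have ha (k : ℤ) (n : ℕ) : ‖fwd A k n (P (k % m) (w k))‖ ≤ C ^ 2 * lam ^ n := by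
    rw [← (hAm k n).1]
    calc _ ≤ C * lam ^ n * ‖P (k % m) (w k)‖ := hfwd _ n _ (mem_range_self _)
      _ ≤ C * lam ^ n * C := by
        have := hlam.1
        gcongr
        exact hmap (hP _) k
      _ = C ^ 2 * lam ^ n := by ring
  have hb (k : ℤ) (n : ℕ) : ‖bwd A k n (Q (k % m) (w k))‖ ≤ C ^ 2 * lam ^ n := by
    rw [← (hAm k n).2]
    calc _ ≤ C * lam ^ n * ‖Q (k % m) (w k)‖ := hbwd _ n _ (mem_range_self _)
      _ ≤ C * lam ^ n * C := by
        have := hlam.1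
        gcongr
        exact hmap (hQ _) k
      _ = C ^ 2 * lam ^ n := by ring
  refine ⟨greenSolution A (fun k => P (k % m) (w k)) (fun k => Q (k % m) (w k)),
    periodic_greenSolution hper (fun k => by simp [hw]) (fun k => by simp [hw]),
    norm_greenSolution_le hlam.1.le hlam.2 ha hb, fun k => ?_⟩
  rw [greenSolution_add_one hlam.1.le hlam.2 ha hb, ← add_apply, hPQ,
    ContinuousLinearMap.id_apply]

end
end

section
/- Let B be a Banach space and f : B → B a C¹ diffeomorphism satisfying the C¹ regularity conditions and a generalized (C,λ)-structure. Then f satisfies the finite Lipschitz shadowing property: there exist M, d₀ > 0 such that for any d < d₀, any finite interval I ⊂ ℤ, and any d-pseudotrajectory {y_k}_{k∈I} of f, there exists an exact trajectory {x_k}_{k∈I} (x_{k+1} = f(x_k) for k, k+1 ∈ I) with |x_k − y_k| ≤ Md for all k ∈ I. -/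
open Set Filter

noncomputable section

variable {B : Type*} [NormedAddCommGroup B] [NormedSpace ℝ B] [CompleteSpace B]

section Shadowing

variable {E : Type*} [NormedAddCommGroup E] [NormedSpace ℝ E]

theorem orbitDeriv_succ_comp (f : E → E) (Df : E → E →L[ℝ] E) (n : ℕ) (x : E) :
    orbitDeriv f Df (n + 1) x = Df (f^[n] x) ∘L orbitDeriv f Df n x := by
  induction n generalizing x with
  | zero => ext v; simp [orbitDeriv]
  | succ n ih =>
    rw [orbitDeriv, ih (f x), Function.iterate_succ_apply, ContinuousLinearMap.comp_assoc]
    rfl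

theorem sum_range_pow_le_inv {q : ℝ} (h0 : 0 < q) (h1 : q < 1) (N : ℕ) :
    ∑ i ∈ Finset.range N, q ^ i ≤ (1 - q)⁻¹ := by
  rw [← tsum_geometric_of_lt_one h0.le h1]
  exact (summable_geometric_of_lt_one h0.le h1).sum_le_tsum _ fun i _ => by positivity

/-- A contraction of a closed ball for the supremum norm, expressed pointwise, has a fixed
point. -/
theorem exists_fixed_of_pointwise_contraction {E : Type*} [NormedAddCommGroup E]
    [CompleteSpace E] {ι : Type*} {ρ q : ℝ}
    (hρ : 0 ≤ ρ) (hq0 : 0 ≤ q) (hq1 : q < 1) (T : (ι → E) → ι → E)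
    (hmaps : ∀ z, (∀ k, ‖z k‖ ≤ ρ) → ∀ k, ‖T z k‖ ≤ ρ)
    (hcontr : ∀ z z' : ι → E, (∀ k, ‖z k‖ ≤ ρ) → (∀ k, ‖z' k‖ ≤ ρ) → ∀ c : ℝ, 0 ≤ c →
      (∀ k, ‖z k - z' k‖ ≤ c) → ∀ k, ‖T z k - T z' k‖ ≤ q * c) :
    ∃ z, (∀ k, ‖z k‖ ≤ ρ) ∧ T z = z := by
  let _ : TopologicalSpace ι := ⊥
  have : DiscreteTopology ι := ⟨rfl⟩
  let X := Metric.closedBall (0 : BoundedContinuousFunction ι E) ρ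
  have hX : ∀ z : X, ∀ k, ‖z.1 k‖ ≤ ρ := fun z k =>
    (z.1.norm_coe_le_norm k).trans (mem_closedBall_zero_iff.1 z.2)
  let T' : X → X := fun z =>
    ⟨BoundedContinuousFunction.ofNormedAddCommGroupDiscrete (T z.1) ρ (hmaps _ (hX z)),
      mem_closedBall_zero_iff.2 (BoundedContinuousFunction.norm_ofNormedAddCommGroup_le _ hρ _)⟩
  have hT' : ContractingWith ⟨q, hq0⟩ T' := by
    refine ⟨by exact_mod_cast hq1, LipschitzWith.of_dist_le_mul fun z z' => ?_⟩
    refine (BoundedContinuousFunction.dist_le (by positivity)).2 fun k => ?_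
    rw [dist_eq_norm]
    refine hcontr _ _ (hX z) (hX z') _ dist_nonneg (fun j => ?_) k
    rw [← dist_eq_norm]
    exact BoundedContinuousFunction.dist_coe_le_dist j
  have : CompleteSpace X := Metric.isClosed_closedBall.completeSpace_coe
  have : Nonempty X := ⟨⟨0, Metric.mem_closedBall_self hρ⟩⟩
  refine ⟨(hT'.fixedPoint T').1, hX _, ?_⟩
  have h := hT'.fixedPoint_isFixedPt
  exact congrArg (fun z : X => (z.1 : ι → E)) h

/-- Truncated Green operator: forward propagators `F`, backward propagators `G`. -/
def truncGreen (F G : ℕ → ℤ → E →L[ℝ] E) (N : ℕ) (w : ℤ → E) (k : ℤ) : E :=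
  ∑ i ∈ Finset.range (N + 1), F i (k - i) (w (k - i)) -
    ∑ i ∈ Finset.range N, G (i + 1) (k + 1 + i) (w (k + 1 + i))

theorem truncGreen_sub (F G : ℕ → ℤ → E →L[ℝ] E) (N : ℕ) (w w' : ℤ → E) (k : ℤ) :
    truncGreen F G N (w - w') k = truncGreen F G N w k - truncGreen F G N w' k := by
  simp only [truncGreen, Pi.sub_apply, map_sub, Finset.sum_sub_distrib]
  abel

theorem norm_sum_apply_le {c D q : ℝ} (hq0 : 0 < q) (hq1 : q < 1) (hD : 0 ≤ D) (N : ℕ)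
    (H : ℕ → E →L[ℝ] E) (u : ℕ → E) (hH : ∀ i < N, ‖H i‖ ≤ D * q ^ i) (hu : ∀ i, ‖u i‖ ≤ c) :
    ‖∑ i ∈ Finset.range N, H i (u i)‖ ≤ D * (1 - q)⁻¹ * c := by
  have hc : 0 ≤ c := (norm_nonneg _).trans (hu 0)
  calc ‖∑ i ∈ Finset.range N, H i (u i)‖
      ≤ ∑ i ∈ Finset.range N, D * q ^ i * c := norm_sum_le_of_le _ fun i hi =>
        (H i).le_of_opNorm_le_of_le (hH i (Finset.mem_range.1 hi)) (hu i)
    _ = D * (∑ i ∈ Finset.range N, q ^ i) * c := by rw [Finset.mul_sum, Finset.sum_mul]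
    _ ≤ D * (1 - q)⁻¹ * c := by
        gcongr
        exact sum_range_pow_le_inv hq0 hq1 N

theorem norm_truncGreen_le {F G : ℕ → ℤ → E →L[ℝ] E} {N : ℕ} {D q c : ℝ}
    (hq0 : 0 < q) (hq1 : q < 1) (hD : 0 ≤ D)
    (hF : ∀ i k, ‖F i k‖ ≤ D * q ^ i) (hG : ∀ i k, ‖G i k‖ ≤ D * q ^ i)
    {w : ℤ → E} (hw : ∀ k, ‖w k‖ ≤ c) (k : ℤ) :
    ‖truncGreen F G N w k‖ ≤ 2 * D * (1 - q)⁻¹ * c := by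
  have h1 := norm_sum_apply_le hq0 hq1 hD (N + 1) (fun i => F i (k - i)) (fun i => w (k - i))
    (fun i _ => hF i _) (fun i => hw _)
  have h2 := norm_sum_apply_le hq0 hq1 hD N (fun i => G (i + 1) (k + 1 + i))
    (fun i => w (k + 1 + i))
    (fun i _ => (hG _ _).trans (mul_le_mul_of_nonneg_left
      (pow_le_pow_of_le_one hq0.le hq1.le (Nat.le_succ i)) hD)) (fun i => hw _)
  refine (norm_sub_le _ _).trans ?_
  linarith

theorem truncGreen_defect (A : ℤ → E →L[ℝ] E) (F G : ℕ → ℤ → E →L[ℝ] E) (N : ℕ)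
    (h0 : ∀ k, F 0 k + G 0 k = ContinuousLinearMap.id ℝ E) (w : ℤ → E) (k : ℤ) :
    truncGreen F G N w (k + 1) - A k (truncGreen F G N w k) - w (k + 1) =
      ∑ i ∈ Finset.range N, (F (i + 1) (k - i) - A k ∘L F i (k - i)) (w (k - i)) +
      ∑ i ∈ Finset.range N,
        (A k ∘L G (i + 1) (k + 1 + i) - G i (k + 1 + i)) (w (k + 1 + i)) -
      A k (F N (k - N) (w (k - N))) - G N (k + 1 + N) (w (k + 1 + N)) := by
  have hw : w (k + 1) = F 0 (k + 1) (w (k + 1)) + G 0 (k + 1) (w (k + 1)) := by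
    rw [← add_apply, h0, ContinuousLinearMap.id_apply]
  have hF : ∑ i ∈ Finset.range (N + 1), F i (k + 1 - i) (w (k + 1 - i)) =
      ∑ i ∈ Finset.range N, F (i + 1) (k - i) (w (k - i)) + F 0 (k + 1) (w (k + 1)) := by
    rw [Finset.sum_range_succ']
    simp
  have hG : ∑ i ∈ Finset.range N, G (i + 1) (k + 1 + 1 + i) (w (k + 1 + 1 + i)) +
      G 0 (k + 1) (w (k + 1)) =
      ∑ i ∈ Finset.range N, G i (k + 1 + i) (w (k + 1 + i)) +
        G N (k + 1 + N) (w (k + 1 + N)) := by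
    rw [← Finset.sum_range_succ (fun i : ℕ => G i (k + 1 + i) (w (k + 1 + i))),
      Finset.sum_range_succ']
    have hshift : ∀ i : ℤ, k + 1 + 1 + i = k + 1 + (i + 1) := fun i => by ring
    simp only [Nat.cast_add, Nat.cast_one, Nat.cast_zero, add_zero, hshift]
  nth_rewrite 1 [hw]
  rw [truncGreen, truncGreen, hF, eq_sub_of_add_eq hG, Finset.sum_range_succ]
  simp only [sub_apply, ContinuousLinearMap.comp_apply, map_sub, map_add,
    map_sum, Finset.sum_sub_distrib]
  abel

theorem norm_truncGreen_defect_le {A : ℤ → E →L[ℝ] E} {F G : ℕ → ℤ → E →L[ℝ] E} {N : ℕ}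
    {D q c R ε : ℝ} (hq0 : 0 < q) (hq1 : q < 1) (hε : 0 ≤ ε)
    (hA : ∀ k, ‖A k‖ ≤ R) (h0 : ∀ k, F 0 k + G 0 k = ContinuousLinearMap.id ℝ E)
    (hF : ∀ i k, ‖F i k‖ ≤ D * q ^ i) (hG : ∀ i k, ‖G i k‖ ≤ D * q ^ i)
    (hFA : ∀ i < N, ∀ k : ℤ, ‖F (i + 1) (k - i) - A k ∘L F i (k - i)‖ ≤ ε * q ^ i)
    (hGA : ∀ i < N, ∀ k : ℤ,
      ‖A k ∘L G (i + 1) (k + 1 + i) - G i (k + 1 + i)‖ ≤ ε * q ^ i)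
    {w : ℤ → E} (hw : ∀ k, ‖w k‖ ≤ c) (k : ℤ) :
    ‖truncGreen F G N w (k + 1) - A k (truncGreen F G N w k) - w (k + 1)‖ ≤
      ((R + 1) * (D * q ^ N) + 2 * ε * (1 - q)⁻¹) * c := by
  rw [truncGreen_defect A F G N h0]
  have h1 := norm_sum_apply_le hq0 hq1 hε N (fun i => F (i + 1) (k - i) - A k ∘L F i (k - i))
    (fun i => w (k - i)) (fun i hi => hFA i hi k) (fun i => hw _)
  have h2 := norm_sum_apply_le hq0 hq1 hε N
    (fun i => A k ∘L G (i + 1) (k + 1 + i) - G i (k + 1 + i))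
    (fun i => w (k + 1 + i)) (fun i hi => hGA i hi k) (fun i => hw _)
  have h3 : ‖A k (F N (k - N) (w (k - N)))‖ ≤ R * (D * q ^ N * c) :=
    (A k).le_of_opNorm_le_of_le (hA k)
      ((F N (k - N)).le_of_opNorm_le_of_le (hF _ _) (hw _))
  have h4 : ‖G N (k + 1 + N) (w (k + 1 + N))‖ ≤ D * q ^ N * c :=
    (G N (k + 1 + N)).le_of_opNorm_le_of_le (hG _ _) (hw _)
  refine (norm_sub_le_of_le (norm_sub_le_of_le (norm_add_le_of_le h1 h2) h3) h4).trans
    (le_of_eq ?_)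
  ring

/-- Shadowing from an approximate right inverse `S` of `v ↦ (v (k + 1) - Df (y k) (v k))`. -/
theorem exists_orbit_of_approx_inverse [CompleteSpace E] {f : E → E} {Df : E → E →L[ℝ] E}
    (hf : ∀ x, HasFDerivAt f (Df x) x) {y : ℤ → E} {d L : ℝ} (hd : 0 ≤ d) (hL : 0 < L)
    (hy : ∀ k, ‖y (k + 1) - f (y k)‖ ≤ d)
    (hDf : ∀ k, ∀ v : E, ‖v‖ ≤ 4 * L * d → ‖Df (y k + v) - Df (y k)‖ ≤ (4 * L)⁻¹)
    (S : (ℤ → E) → ℤ → E) (hsub : ∀ w w' k, S (w - w') k = S w k - S w' k)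
    (hS : ∀ (w : ℤ → E) (c : ℝ), (∀ k, ‖w k‖ ≤ c) → ∀ k, ‖S w k‖ ≤ L * c)
    (hSdef : ∀ (w : ℤ → E) (c : ℝ), (∀ k, ‖w k‖ ≤ c) → ∀ k,
      ‖S w (k + 1) - Df (y k) (S w k) - w (k + 1)‖ ≤ 1 / 2 * c) :
    ∃ x : ℤ → E, (∀ k, x (k + 1) = f (x k)) ∧ ∀ k, ‖x k - y k‖ ≤ 4 * L * d := by
  have hstep : ∀ k, ∀ u u' : E, ‖u‖ ≤ 4 * L * d → ‖u'‖ ≤ 4 * L * d →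
      ‖f (y k + u) - f (y k + u') - Df (y k) (u - u')‖ ≤ (4 * L)⁻¹ * ‖u - u'‖ := by
    intro k u u' hu hu'
    have := (convex_closedBall (y k) (4 * L * d)).norm_image_sub_le_of_norm_hasFDerivWithin_le'
      (f := f) (f' := Df) (φ := Df (y k)) (C := (4 * L)⁻¹) (x := y k + u') (y := y k + u)
      (fun x _ => (hf x).hasFDerivWithinAt)
      (fun x hx => by
        have := hDf k (x - y k) (mem_closedBall_iff_norm.1 hx)
        rwa [add_sub_cancel] at this)
      (by simpa using hu') (by simpa using hu)
    simpa using this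
  let T : (ℤ → E) → ℤ → E := fun z k =>
    f (y (k - 1) + S z (k - 1)) - y k - S z k + z k
  have hcontr : ∀ z z' : ℤ → E, (∀ k, ‖z k‖ ≤ 4 * d) → (∀ k, ‖z' k‖ ≤ 4 * d) → ∀ c : ℝ,
      0 ≤ c → (∀ k, ‖z k - z' k‖ ≤ c) → ∀ k, ‖T z k - T z' k‖ ≤ 3 / 4 * c := by
    intro z z' hz hz' c hc hzz k
    have e1 := hstep (k - 1) (S z (k - 1)) (S z' (k - 1))
      ((hS z _ hz _).trans_eq (by ring)) ((hS z' _ hz' _).trans_eq (by ring))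
    have e2 := hSdef (z - z') c hzz (k - 1)
    have e3 := hS (z - z') c hzz (k - 1)
    rw [hsub] at e3
    rw [hsub, hsub, sub_add_cancel, Pi.sub_apply] at e2
    have e4 : (4 * L)⁻¹ * ‖S z (k - 1) - S z' (k - 1)‖ ≤ 1 / 4 * c := by
      calc _ ≤ (4 * L)⁻¹ * (L * c) := by gcongr
        _ = _ := by field_simp
    have e5 : T z k - T z' k =
        (f (y (k - 1) + S z (k - 1)) - f (y (k - 1) + S z' (k - 1)) -
          Df (y (k - 1)) (S z (k - 1) - S z' (k - 1))) -
        (S z k - S z' k - Df (y (k - 1)) (S z (k - 1) - S z' (k - 1)) - (z k - z' k)) := by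
      simp only [T]; abel
    rw [e5]
    refine (norm_sub_le _ _).trans ?_
    linarith
  have hS0 : ∀ k, S 0 k = 0 := fun k => by simpa using hsub 0 0 k
  have hmaps : ∀ z, (∀ k, ‖z k‖ ≤ 4 * d) → ∀ k, ‖T z k‖ ≤ 4 * d := by
    intro z hz k
    have e1 := hcontr z 0 hz (by simpa using hd) (4 * d) (by positivity) (by simpa using hz) k
    have e2 : ‖T 0 k‖ ≤ d := by
      have := hy (k - 1)
      rw [sub_add_cancel, norm_sub_rev] at this
      simpa [T, hS0] using this
    have e3 := norm_add_le (T z k - T 0 k) (T 0 k)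
    rw [sub_add_cancel] at e3
    linarith
  obtain ⟨z, hz, hfix⟩ := exists_fixed_of_pointwise_contraction (by positivity)
    (by norm_num) (by norm_num) T hmaps hcontr
  refine ⟨fun k => y k + S z k, fun k => ?_, fun k => ?_⟩
  · have h := congrFun hfix (k + 1)
    simp only [T, add_sub_cancel_right] at h
    have h' := add_eq_right.1 h
    rw [sub_sub, sub_eq_zero] at h'
    exact h'.symm
  · rw [add_sub_cancel_left]
    exact (hS z _ hz k).trans_eq (by ring)

theorem norm_iterate_sub_le {E : Type*} [NormedAddCommGroup E] {g : E → E} {L δ : ℝ} (hL : 0 ≤ L)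
    (hg : ∀ x x', ‖g x - g x'‖ ≤ L * ‖x - x'‖) {y : ℤ → E}
    (hy : ∀ k, ‖y (k + 1) - g (y k)‖ ≤ δ) (i : ℕ) (k : ℤ) :
    ‖g^[i] (y k) - y (k + i)‖ ≤ (∑ j ∈ Finset.range i, L ^ j) * δ := by
  induction i with
  | zero => simp
  | succ i ih =>
    have h1 := hg (g^[i] (y k)) (y (k + i))
    have h2 := hy (k + i)
    rw [norm_sub_rev] at h2
    rw [Function.iterate_succ_apply', geom_sum_succ]
    have h3 := norm_sub_le_norm_sub_add_norm_sub (g (g^[i] (y k))) (g (y (k + i))) (y (k + i + 1))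
    have h4 := mul_le_mul_of_nonneg_left ih hL
    push_cast
    rw [← add_assoc]
    linarith

theorem norm_sub_le_of_hasFDerivAt {g : E → E} {Dg : E → E →L[ℝ] E} {R : ℝ}
    (hg : ∀ x, HasFDerivAt g (Dg x) x) (hR : ∀ x, ‖Dg x‖ ≤ R) (x x' : E) :
    ‖g x - g x'‖ ≤ R * ‖x - x'‖ :=
  convex_univ.norm_image_sub_le_of_norm_hasFDerivWithin_le
    (fun z _ => (hg z).hasFDerivWithinAt) (fun z _ => hR z) (mem_univ _) (mem_univ _)

theorem IsC1Diffeo.comp_deriv_inv {f fInv : E → E} {Df DfInv : E → E →L[ℝ] E}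
    (hf : IsC1Diffeo f fInv Df DfInv) (x : E) :
    Df (fInv x) ∘L DfInv x = ContinuousLinearMap.id ℝ E := by
  obtain ⟨-, hr, h1, h2⟩ := hf
  have h := (h1 (fInv x)).comp x (h2 x)
  rw [hr.comp_eq_id] at h
  exact h.unique (hasFDerivAt_id x)

/-- A pseudotrajectory on `[a, b]` extends to one on `ℤ`, by exact trajectories. -/
theorem exists_extend_pseudotrajectory {E : Type*} [NormedAddCommGroup E] {f fInv : E → E}
    (hinv : Function.RightInverse fInv f) {d : ℝ} (hd : 0 ≤ d) {a b : ℤ} (hab : a ≤ b) {y : ℤ → E}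
    (hy : ∀ k, k ∈ Set.Icc a b → k + 1 ∈ Set.Icc a b → ‖y (k + 1) - f (y k)‖ ≤ d) :
    ∃ y' : ℤ → E, (∀ k, ‖y' (k + 1) - f (y' k)‖ ≤ d) ∧ ∀ k ∈ Set.Icc a b, y' k = y k := by
  let y' : ℤ → E := fun k =>
    if k < a then fInv^[(a - k).toNat] (y a)
    else if k ≤ b then y k else f^[(k - b).toNat] (y b)
  have hin : ∀ k ∈ Set.Icc a b, y' k = y k := fun k hk => by
    simp only [y']
    rw [if_neg (not_lt.2 hk.1), if_pos hk.2]
  have hlt : ∀ k ≤ a, y' k = fInv^[(a - k).toNat] (y a) := fun k hk => by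
    rcases hk.lt_or_eq with h | rfl
    · simp only [y']; rw [if_pos h]
    · rw [hin k ⟨le_rfl, hab⟩]; simp
  have hgt : ∀ k, b ≤ k → y' k = f^[(k - b).toNat] (y b) := fun k hk => by
    rcases hk.lt_or_eq with h | rfl
    · simp only [y']; rw [if_neg (by omega), if_neg (by omega)]
    · rw [hin b ⟨hab, le_rfl⟩]; simp
  refine ⟨y', fun k => ?_, hin⟩
  rcases lt_or_ge k a with h | h
  · rw [hlt k h.le, hlt (k + 1) h, show (a - k).toNat = (a - (k + 1)).toNat + 1 by omega,
      Function.iterate_succ_apply', hinv]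
    simpa using hd
  rcases lt_or_ge k b with h' | h'
  · rw [hin k ⟨h, h'.le⟩, hin (k + 1) ⟨by omega, h'⟩]
    exact hy k ⟨h, h'.le⟩ ⟨by omega, h'⟩
  · rw [hgt k h', hgt (k + 1) (by omega), show (k + 1 - b).toNat = (k - b).toNat + 1 by omega,
      Function.iterate_succ_apply']
    simpa using hd

theorem C1Reg.exists_le {f : E → E} {Df DfInv : E → E →L[ℝ] E} {R : ℝ} {r : ℝ → ℝ}
    (hreg : C1Reg f Df DfInv R r) {ε : ℝ} (hε : 0 < ε) :
    ∃ ρ > 0, ∀ x x' : E, ‖x - x'‖ ≤ ρ → ‖Df x - Df x'‖ ≤ ε := by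
  obtain ⟨-, hmono, -, hlim, -, -, -, hDf⟩ := hreg
  obtain ⟨ρ, hle, hpos⟩ :=
    ((hlim.eventually_le_const hε).and self_mem_nhdsWithin).exists
  refine ⟨ρ, hpos, fun x x' h => ?_⟩
  have := hDf x' (x - x')
  rw [add_sub_cancel] at this
  exact this.trans ((hmono (norm_nonneg _) (le_of_lt hpos) h).trans hle)

/-- Norm bound for the propagator of a family of subspaces `range (P x)` contracted by `Dg`. -/
theorem norm_orbitDeriv_comp_le {g : E → E} {Dg P : E → E →L[ℝ] E} {C q : ℝ} (hC : 0 < C)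
    (hq : 0 < q) (hP : ∀ x, ‖P x‖ ≤ C)
    (h : ∀ x (n : ℕ) (v : E), v ∈ Set.range (P x) →
      ‖orbitDeriv g Dg n x v‖ ≤ C * q ^ n * ‖v‖) (n : ℕ) (x : E) :
    ‖orbitDeriv g Dg n x ∘L P x‖ ≤ C ^ 2 * q ^ n := by
  refine ContinuousLinearMap.opNorm_le_bound _ (by positivity) fun v => ?_
  calc ‖orbitDeriv g Dg n x (P x v)‖ ≤ C * q ^ n * ‖P x v‖ := h x n _ ⟨v, rfl⟩
    _ ≤ C * q ^ n * (C * ‖v‖) := by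
        gcongr
        exact (P x).le_of_opNorm_le (hP x) v
    _ = C ^ 2 * q ^ n * ‖v‖ := by ring

/-- Lipschitz shadowing of bi-infinite pseudotrajectories. -/
theorem exists_lipschitz_shadowing [CompleteSpace E]
    {f fInv : E → E} {Df DfInv : E → E →L[ℝ] E} {R : ℝ} {r : ℝ → ℝ}
    (hf : IsC1Diffeo f fInv Df DfInv) (hreg : C1Reg f Df DfInv R r)
    {C lam : ℝ} (hC : 0 < C) (hlam : lam ∈ Set.Ioo (0 : ℝ) 1)
    {P Q : E → E →L[ℝ] E} (hCL : IsGenCL f fInv Df DfInv C lam P Q) :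
    ∃ M d₀ : ℝ, 0 < M ∧ 0 < d₀ ∧ ∀ d : ℝ, 0 < d → d < d₀ → ∀ y : ℤ → E,
      (∀ k, ‖y (k + 1) - f (y k)‖ ≤ d) →
      ∃ x : ℤ → E, (∀ k, x (k + 1) = f (x k)) ∧ ∀ k, ‖x k - y k‖ ≤ M * d := by
  obtain ⟨hPQ, hP, hQ, -, -, hs, hu⟩ := hCL
  obtain ⟨hl0, hl1⟩ := hlam
  have hcomp := hf.comp_deriv_inv
  obtain ⟨hleft, -, hd1, hd2⟩ := hf
  have hsmall := fun ε hε => hreg.exists_le (ε := ε) hε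
  obtain ⟨hR, -, -, -, -, hR1, hR2, -⟩ := hreg
  have hl : 0 < (1 - lam)⁻¹ := inv_pos.2 (sub_pos.2 hl1)
  set L : ℝ := 2 * C ^ 2 * (1 - lam)⁻¹ with hLdef
  have hL : 0 < L := by positivity
  obtain ⟨N, hN⟩ : ∃ N : ℕ, (R + 1) * (C ^ 2 * lam ^ N) ≤ 1 / 4 := by
    obtain ⟨N, hN⟩ := exists_pow_lt_of_lt_one
      (show 0 < ((R + 1) * C ^ 2 * 4)⁻¹ by positivity) hl1
    refine ⟨N, ?_⟩
    calc (R + 1) * (C ^ 2 * lam ^ N)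
        ≤ (R + 1) * (C ^ 2 * ((R + 1) * C ^ 2 * 4)⁻¹) := by gcongr
      _ = 1 / 4 := by field_simp
  obtain ⟨ρ, hρ, hDf⟩ := hsmall (4 * L)⁻¹ (by positivity)
  set K : ℝ := ∑ j ∈ Finset.range (N + 1), R ^ j with hK
  have hK0 : 0 < K := by
    rw [hK, Finset.sum_range_succ']
    positivity
  refine ⟨4 * L, min (ρ / (4 * L)) (ρ / (K * (R + 1))), by positivity, by positivity, ?_⟩
  intro d hd hdd y hy
  have hρ1 : 4 * L * d ≤ ρ := by
    have := (lt_div_iff₀ (by positivity)).1 (hdd.trans_le (min_le_left _ _))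
    linarith
  have hρ2 : K * ((R + 1) * d) ≤ ρ := by
    have := (lt_div_iff₀ (by positivity)).1 (hdd.trans_le (min_le_right _ _))
    linarith
  have hKi : ∀ i ≤ N, ∀ δ, 0 ≤ δ → δ ≤ (R + 1) * d →
      (∑ j ∈ Finset.range (i + 1), R ^ j) * δ ≤ ρ := fun i hi δ hδ0 hδ => by
    refine le_trans ?_ hρ2
    have : ∑ j ∈ Finset.range (i + 1), R ^ j ≤ K :=
      Finset.sum_le_sum_of_subset_of_nonneg (Finset.range_subset_range.2 (by omega))
        fun j _ _ => by positivity
    gcongr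
  have hforw : ∀ i < N, ∀ k : ℤ, ‖f^[i] (y (k - i)) - y k‖ ≤ ρ := fun i hi k => by
    have h := norm_iterate_sub_le hR.le (norm_sub_le_of_hasFDerivAt hd1 hR1) hy i (k - i)
    rw [sub_add_cancel] at h
    refine h.trans (le_trans ?_ (hKi i hi.le d hd.le (by nlinarith)))
    gcongr
    omega
  have hback : ∀ i < N, ∀ k : ℤ, ‖fInv^[i + 1] (y (k + 1 + i)) - y k‖ ≤ ρ := fun i hi k => by
    have h := norm_iterate_sub_le (y := fun j => y (-j)) (δ := R * d) hR.le
      (norm_sub_le_of_hasFDerivAt hd2 hR2) (fun j => by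
        have h1 := norm_sub_le_of_hasFDerivAt hd2 hR2 (y (-j)) (f (y (-(j + 1))))
        have h2 := hy (-(j + 1))
        rw [hleft, norm_sub_rev] at h1
        rw [show -(j + 1) + 1 = -j by ring] at h2
        exact h1.trans (by gcongr)) (i + 1) (-(k + 1 + i))
    simp only [neg_neg] at h
    rw [show -(-(k + 1 + (i : ℤ)) + ((i + 1 : ℕ) : ℤ)) = k by push_cast; ring] at h
    exact h.trans (hKi i hi.le _ (by positivity) (by linarith))
  let F : ℕ → ℤ → E →L[ℝ] E := fun i k => orbitDeriv f Df i (y k) ∘L P (y k)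
  let G : ℕ → ℤ → E →L[ℝ] E := fun i k => orbitDeriv fInv DfInv i (y k) ∘L Q (y k)
  have hF : ∀ i k, ‖F i k‖ ≤ C ^ 2 * lam ^ i := fun i k =>
    norm_orbitDeriv_comp_le hC hl0 hP hs i (y k)
  have hG : ∀ i k, ‖G i k‖ ≤ C ^ 2 * lam ^ i := fun i k =>
    norm_orbitDeriv_comp_le hC hl0 hQ hu i (y k)
  have hFA : ∀ i < N, ∀ k : ℤ, ‖F (i + 1) (k - i) - Df (y k) ∘L F i (k - i)‖ ≤
      (4 * L)⁻¹ * C ^ 2 * lam ^ i := fun i hi k => by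
    have e : F (i + 1) (k - i) - Df (y k) ∘L F i (k - i) =
        (Df (f^[i] (y (k - i))) - Df (y k)) ∘L F i (k - i) := by
      simp only [F]
      rw [orbitDeriv_succ_comp, ContinuousLinearMap.sub_comp, ContinuousLinearMap.comp_assoc]
    rw [e, mul_assoc]
    exact (ContinuousLinearMap.opNorm_comp_le _ _).trans
      (mul_le_mul (hDf _ _ (hforw i hi k)) (hF _ _) (norm_nonneg _) (by positivity))
  have hGA : ∀ i < N, ∀ k : ℤ,
      ‖Df (y k) ∘L G (i + 1) (k + 1 + i) - G i (k + 1 + i)‖ ≤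
        (4 * L)⁻¹ * C ^ 2 * lam ^ i := fun i hi k => by
    have e : Df (y k) ∘L G (i + 1) (k + 1 + i) - G i (k + 1 + i) =
        (Df (y k) - Df (fInv^[i + 1] (y (k + 1 + i)))) ∘L G (i + 1) (k + 1 + i) := by
      rw [ContinuousLinearMap.sub_comp]
      congr 1
      simp only [G]
      rw [orbitDeriv_succ_comp, Function.iterate_succ_apply', ← ContinuousLinearMap.comp_assoc,
        ← ContinuousLinearMap.comp_assoc, hcomp, ContinuousLinearMap.id_comp]
    rw [e, mul_assoc]
    refine (ContinuousLinearMap.opNorm_comp_le _ _).trans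
      (mul_le_mul (hDf _ _ ?_) ((hG _ _).trans ?_) (norm_nonneg _) (by positivity))
    · rw [norm_sub_rev]
      exact hback i hi k
    · exact mul_le_mul_of_nonneg_left
        (pow_le_pow_of_le_one hl0.le hl1.le (Nat.le_succ i)) (by positivity)
  refine exists_orbit_of_approx_inverse hd1 hd.le hL hy
    (fun k v hv => hDf _ _ (by simpa using hv.trans hρ1)) (truncGreen F G N)
    (truncGreen_sub F G N)
    (fun w c hw k => norm_truncGreen_le hl0 hl1 (by positivity) hF hG hw k)
    (fun w c hw k => ?_)
  have hc : 0 ≤ c := (norm_nonneg _).trans (hw 0)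
  refine (norm_truncGreen_defect_le (A := fun k => Df (y k)) hl0 hl1
    (ε := (4 * L)⁻¹ * C ^ 2) (by positivity) (fun k => hR1 _)
    (fun k => by simpa [F, G, orbitDeriv] using hPQ (y k)) hF hG hFA hGA hw k).trans ?_
  have hε : 2 * ((4 * L)⁻¹ * C ^ 2) * (1 - lam)⁻¹ = 1 / 4 := by
    calc _ = (4 * L)⁻¹ * L := by rw [hLdef]; ring
      _ = 1 / 4 := by field_simp
  rw [hε]
  gcongr
  linarith

end Shadowing

/-- Finite Lipschitz shadowing: a `C¹` diffeomorphism of a Banach space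
satisfying the `C¹` regularity conditions and a generalized `(C, λ)`-structure has the
finite Lipschitz shadowing property. -/
theorem statement7
    {B : Type*} [NormedAddCommGroup B] [NormedSpace ℝ B] [CompleteSpace B]
    (f fInv : B → B) (Df DfInv : B → B →L[ℝ] B) (R : ℝ) (r : ℝ → ℝ)
    (hf : IsC1Diffeo f fInv Df DfInv) (hreg : C1Reg f Df DfInv R r)
    (C lam : ℝ) (hC : 0 < C) (hlam : lam ∈ Set.Ioo (0 : ℝ) 1)
    (P Q : B → B →L[ℝ] B) (hCL : IsGenCL f fInv Df DfInv C lam P Q) :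
    ∃ M d₀ : ℝ, 0 < M ∧ 0 < d₀ ∧
      ∀ d : ℝ, 0 < d → d < d₀ →
        ∀ a b : ℤ, ∀ y : ℤ → B,
          (∀ k, k ∈ Set.Icc a b → k + 1 ∈ Set.Icc a b → ‖y (k + 1) - f (y k)‖ ≤ d) →
          ∃ x : ℤ → B,
            (∀ k, k ∈ Set.Icc a b → k + 1 ∈ Set.Icc a b → x (k + 1) = f (x k)) ∧
            ∀ k ∈ Set.Icc a b, ‖x k - y k‖ ≤ M * d := by
  obtain ⟨M, d₀, hM, hd₀, hsh⟩ := exists_lipschitz_shadowing hf hreg hC hlam hCL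
  refine ⟨M, d₀, hM, hd₀, fun d hd hdd a b y hy => ?_⟩
  rcases lt_or_ge b a with hab | hab
  · exact ⟨y, fun k hk => absurd (hk.1.trans hk.2) (not_le.2 hab),
      fun k hk => absurd (hk.1.trans hk.2) (not_le.2 hab)⟩
  obtain ⟨y', hy', hyy⟩ := exists_extend_pseudotrajectory hf.2.1 hd.le hab hy
  obtain ⟨x, hx, hxy⟩ := hsh d hd hdd y' hy'
  exact ⟨x, fun k _ _ => hx k, fun k hk => hyy k hk ▸ hxy k⟩

end
end

section
/- Let B be a Banach space and f : B → B a C¹ diffeomorphism satisfying the C¹ regularity conditions. Assume there exist d₁, M > 0 such that for every d < d₁ and every d-pseudotrajectory {y_k}_{k∈ℤ} of f, the sequence of differentials {B_k = Df(y_k)}_{k∈ℤ} satisfies the bounded solution property on ℤ with constant M. Then f has the Lipschitz shadowing property. -/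
open Set Filter

noncomputable section

variable {B : Type*} [NormedAddCommGroup B] [NormedSpace ℝ B] [CompleteSpace B]

/-- The inhomogeneous linear equation along a sequence with the bounded solution property is
solvable with linear control on the solution by the right-hand side. -/
theorem BSP.exists_solution_le {E : Type*} [NormedAddCommGroup E] [NormedSpace ℝ E]
    {A : ℤ → E →L[ℝ] E} {L : ℝ} (h : BSP Set.univ A L) {d : ℝ} (hd : 0 < d) (w : ℤ → E)
    (hw : ∀ k, ‖w k‖ ≤ d) :
    ∃ v : ℤ → E, (∀ k, ‖v k‖ ≤ L * d) ∧ ∀ k, v (k + 1) = A k (v k) + w (k + 1) := by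
  obtain ⟨v, hv, hvA⟩ := h (fun k => d⁻¹ • w k) fun k _ => by
    rw [norm_smul, norm_inv, Real.norm_of_nonneg hd.le, inv_mul_le_iff₀ hd, mul_one]
    exact hw _
  refine ⟨fun k => d • v k, fun k => ?_, fun k => ?_⟩
  · rw [norm_smul, Real.norm_of_nonneg hd.le, mul_comm]
    exact mul_le_mul_of_nonneg_right (hv k (mem_univ k)) hd.le
  · simp only [hvA k ⟨mem_univ _, mem_univ _⟩, smul_add, map_smul, smul_inv_smul₀ hd.ne']

/-- If every pseudotrajectory with small error `d` can be corrected, by a displacement of size at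
most `L * d`, to a pseudotrajectory with error `d / 2`, then every such pseudotrajectory is
shadowed by an exact trajectory at distance at most `2 * L * d`. -/
theorem exists_trajectory_of_halving {E : Type*} [MetricSpace E] [CompleteSpace E]
    {f : E → E} (hf : Continuous f) {L d₀ : ℝ}
    (hstep : ∀ d : ℝ, 0 < d → d < d₀ → ∀ y : ℤ → E, (∀ k, dist (y (k + 1)) (f (y k)) ≤ d) →
      ∃ z : ℤ → E, (∀ k, dist (z (k + 1)) (f (z k)) ≤ d / 2) ∧ ∀ k, dist (y k) (z k) ≤ L * d)
    {d : ℝ} (hd : 0 < d) (hdd : d < d₀) (y : ℤ → E)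
    (hy : ∀ k, dist (y (k + 1)) (f (y k)) ≤ d) :
    ∃ x : ℤ → E, (∀ k, x (k + 1) = f (x k)) ∧ ∀ k, dist (y k) (x k) ≤ 2 * L * d := by
  choose! F hFerr hFdist using hstep
  let Y : ℕ → ℤ → E := fun n => Nat.rec y (fun n z => F (d / 2 ^ n) z) n
  have hpos (n : ℕ) : 0 < d / 2 ^ n := by positivity
  have hlt (n : ℕ) : d / 2 ^ n < d₀ :=
    (div_le_self hd.le (one_le_pow₀ one_le_two)).trans_lt hdd
  have herr (n : ℕ) : ∀ k, dist (Y n (k + 1)) (f (Y n k)) ≤ d / 2 ^ n := by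
    induction n with
    | zero => simpa [Y] using hy
    | succ n ih =>
      intro k
      rw [pow_succ, ← div_div]
      exact hFerr _ (hpos n) (hlt n) _ ih k
  have hdist (k : ℤ) (n : ℕ) : dist (Y n k) (Y (n + 1) k) ≤ 2 * L * d / 2 / 2 ^ n := by
    refine (hFdist _ (hpos n) (hlt n) _ (herr n) k).trans_eq ?_
    ring
  choose x hx using fun k =>
    cauchySeq_tendsto_of_complete (cauchySeq_of_le_geometric_two (hdist k))
  refine ⟨x, fun k => ?_, fun k => dist_le_of_le_geometric_two_of_tendsto₀ (hdist k) (hx k)⟩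
  have hlim : Tendsto (fun n : ℕ => d / 2 ^ n) atTop (nhds 0) :=
    tendsto_const_nhds.div_atTop (tendsto_pow_atTop_atTop_of_one_lt one_lt_two)
  exact dist_le_zero.1 <| le_of_tendsto_of_tendsto'
    ((hx (k + 1)).dist ((hf.tendsto _).comp (hx k))) hlim fun n => herr n k

/-- If the differentials of `f` along every `d`-pseudotrajectory
(`d < d₁`) satisfy the bounded solution property on `ℤ` with a uniform constant `M`,
then `f` has the Lipschitz shadowing property. -/
theorem statement8
    {B : Type*} [NormedAddCommGroup B] [NormedSpace ℝ B] [CompleteSpace B]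
    (f fInv : B → B) (Df DfInv : B → B →L[ℝ] B) (R : ℝ) (r : ℝ → ℝ)
    (hf : IsC1Diffeo f fInv Df DfInv) (hreg : C1Reg f Df DfInv R r)
    (d₁ M : ℝ) (hd₁ : 0 < d₁) (hM : 0 < M)
    (hbsp : ∀ d : ℝ, 0 < d → d < d₁ → ∀ y : ℤ → B,
      (∀ k, ‖y (k + 1) - f (y k)‖ ≤ d) → BSP Set.univ (fun k => Df (y k)) M) :
    ∃ M' d₀ : ℝ, 0 < M' ∧ 0 < d₀ ∧
      ∀ d : ℝ, 0 < d → d < d₀ → ∀ y : ℤ → B,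
        (∀ k, ‖y (k + 1) - f (y k)‖ ≤ d) →
        ∃ x : ℤ → B, (∀ k, x (k + 1) = f (x k)) ∧ ∀ k, ‖x k - y k‖ ≤ M' * d := by
  obtain ⟨-, -, hDf, -⟩ := hf
  obtain ⟨-, hmono, hr0, hlim, hrem, -, -, -⟩ := hreg
  have hcont : Continuous f := continuous_iff_continuousAt.2 fun x => (hDf x).continuousAt
  obtain ⟨ε, hε, hrε⟩ : ∃ ε : ℝ, 0 < ε ∧ ∀ z ∈ Ioo 0 ε, r z < 1 / (2 * M) :=
    mem_nhdsGT_iff_exists_Ioo_subset.1 (hlim.eventually_lt_const (by positivity))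
  refine ⟨2 * M, min d₁ (ε / M), by positivity, lt_min hd₁ (by positivity),
    fun d hd hdd y hy => ?_⟩
  have hstep : ∀ d : ℝ, 0 < d → d < min d₁ (ε / M) → ∀ y : ℤ → B,
      (∀ k, dist (y (k + 1)) (f (y k)) ≤ d) →
      ∃ z : ℤ → B, (∀ k, dist (z (k + 1)) (f (z k)) ≤ d / 2) ∧
        ∀ k, dist (y k) (z k) ≤ M * d := by
    intro d hd hdd y hy
    simp only [dist_eq_norm] at hy
    have hMd : 0 < M * d := mul_pos hM hd
    have hMdε : M * d < ε := by
      rw [mul_comm]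
      exact (lt_div_iff₀ hM).1 (hdd.trans_le (min_le_right _ _))
    obtain ⟨v, hv, hvA⟩ := (hbsp d hd (hdd.trans_le (min_le_left _ _)) y hy).exists_solution_le hd
      (fun k => f (y (k - 1)) - y k) fun k => by
        have := hy (k - 1)
        rwa [sub_add_cancel, norm_sub_rev] at this
    refine ⟨fun k => y k + v k, fun k => ?_, fun k => by simpa using hv k⟩
    rw [dist_comm, dist_eq_norm]
    beta_reduce
    rw [hvA k, add_sub_cancel_right]
    calc ‖f (y k + v k) - (y (k + 1) + (Df (y k) (v k) + (f (y k) - y (k + 1))))‖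
        = ‖f (y k + v k) - f (y k) - Df (y k) (v k)‖ := by congr 1; abel
      _ ≤ ‖v k‖ * r ‖v k‖ := hrem _ _
      _ ≤ M * d * (1 / (2 * M)) := by
        refine mul_le_mul (hv k) ?_ (hr0 _ (norm_nonneg _)) hMd.le
        exact (hmono (norm_nonneg _) hMd.le (hv k)).trans (hrε _ ⟨hMd, hMdε⟩).le
      _ = d / 2 := by field_simp
  obtain ⟨x, hx, hxy⟩ := exists_trajectory_of_halving hcont hstep hd hdd y fun k => by
    simpa only [dist_eq_norm] using hy k
  exact ⟨x, hx, fun k => by simpa only [dist_eq_norm, norm_sub_rev] using hxy k⟩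

end
end

section
/- Let B be a Banach space and f : B → B a C¹ diffeomorphism satisfying the C¹ regularity conditions with modulus r, and let M > 0. Let d₀ > 0 satisfy M·r(M d₀) < 1/2. Then for every d < d₀ and every d-pseudotrajectory {y_k}_{k∈ℤ} of f such that the sequence {B_k = Df(y_k)}_{k∈ℤ} satisfies the bounded solution property on ℤ with constant M, there exists a (d/2)-pseudotrajectory {z_k}_{k∈ℤ} of f with |y_k − z_k| ≤ Md for all k ∈ ℤ. -/
open Set Filter

noncomputable section

variable {B : Type*} [NormedAddCommGroup B] [NormedSpace ℝ B] [CompleteSpace B]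

/-- One improvement step: if `M · r(M d₀) < 1/2`, then every
`d`-pseudotrajectory (`d < d₀`) whose differentials satisfy the bounded solution property
on `ℤ` with constant `M` is `M d`-close to some `(d/2)`-pseudotrajectory. -/
theorem statement9
    {B : Type*} [NormedAddCommGroup B] [NormedSpace ℝ B] [CompleteSpace B]
    (f fInv : B → B) (Df DfInv : B → B →L[ℝ] B) (R : ℝ) (r : ℝ → ℝ)
    (hf : IsC1Diffeo f fInv Df DfInv) (hreg : C1Reg f Df DfInv R r)
    (M : ℝ) (hM : 0 < M)
    (d₀ : ℝ) (hd₀ : 0 < d₀) (hsmall : M * r (M * d₀) < 1 / 2) :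
    ∀ d : ℝ, 0 < d → d < d₀ → ∀ y : ℤ → B,
      (∀ k, ‖y (k + 1) - f (y k)‖ ≤ d) →
      BSP Set.univ (fun k => Df (y k)) M →
      ∃ z : ℤ → B,
        (∀ k, ‖z (k + 1) - f (z k)‖ ≤ d / 2) ∧
        ∀ k, ‖y k - z k‖ ≤ M * d := by
  obtain ⟨-, hmono, hr0, -, htaylor, -, -, -⟩ := hreg
  intro d hd hdd y hy hbsp
  obtain ⟨v, hvM, hv⟩ := hbsp (fun k => d⁻¹ • (f (y (k - 1)) - y k)) (by
    intro k _
    rw [add_sub_cancel_right, norm_smul, norm_inv, Real.norm_of_nonneg hd.le, norm_sub_rev,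
      inv_mul_le_iff₀ hd, mul_one]
    exact hy k)
  have hdv : ∀ k, ‖d • v k‖ ≤ M * d := fun k => by
    rw [norm_smul, Real.norm_of_nonneg hd.le, mul_comm]
    exact mul_le_mul_of_nonneg_right (hvM k (Set.mem_univ k)) hd.le
  refine ⟨fun k => y k + d • v k, fun k => ?_, fun k => ?_⟩
  · have hz : d • v (k + 1) = Df (y k) (d • v k) + (f (y k) - y (k + 1)) := by
      rw [hv k ⟨Set.mem_univ _, Set.mem_univ _⟩, add_sub_cancel_right, smul_add,
        smul_inv_smul₀ hd.ne', map_smul]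
    have herr : y (k + 1) + d • v (k + 1) - f (y k + d • v k)
        = -(f (y k + d • v k) - f (y k) - Df (y k) (d • v k)) := by
      rw [hz]; abel
    have hle : ‖d • v k‖ ≤ M * d₀ :=
      (hdv k).trans (mul_le_mul_of_nonneg_left hdd.le hM.le)
    have hr : r ‖d • v k‖ ≤ r (M * d₀) :=
      hmono (norm_nonneg _) (mul_pos hM hd₀).le hle
    calc ‖y (k + 1) + d • v (k + 1) - f (y k + d • v k)‖
        ≤ ‖d • v k‖ * r ‖d • v k‖ := by
          rw [herr, norm_neg]
          exact htaylor _ _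
      _ ≤ M * d * r (M * d₀) :=
          mul_le_mul (hdv k) hr (hr0 _ (norm_nonneg _)) (mul_pos hM hd).le
      _ ≤ d / 2 := by nlinarith
  · rw [sub_add_cancel_left, norm_neg]
    exact hdv k

end
end

section
/- Let B be a reflexive Banach space and f : B → B a C¹ diffeomorphism satisfying the C¹ regularity conditions and a generalized (C,λ)-structure. Then the periodic points of f are dense in the chain-recurrent set of f: for every chain-recurrent point x of f and every ε > 0 there exists a point p ∈ B and an integer N ≥ 1 with f^N(p) = p and |x − p| < ε. Equivalently, CR(f) ⊆ closure(Per(f)). -/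
open Set Filter

noncomputable section

variable {B : Type*} [NormedAddCommGroup B] [NormedSpace ℝ B] [CompleteSpace B]

/-- A point `x` is chain recurrent for `f` if for every `d > 0` there is a finite
`d`-pseudotrajectory starting and ending at `x`. -/
def ChainRecurrentPt {B : Type*} [NormedAddCommGroup B] (f : B → B) (x : B) : Prop :=
  ∀ d : ℝ, 0 < d → ∃ N : ℕ, 0 < N ∧ ∃ y : ℕ → B, y 0 = x ∧ y N = x ∧
    ∀ k < N, ‖y (k + 1) - f (y k)‖ ≤ d

section Shadowing

variable {E : Type*} [NormedAddCommGroup E] [NormedSpace ℝ E]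

theorem orbitDeriv_succ_apply (f : E → E) (Df : E → E →L[ℝ] E) (n : ℕ) (x v : E) :
    orbitDeriv f Df (n + 1) x v = Df (f^[n] x) (orbitDeriv f Df n x v) := by
  induction n generalizing x v with
  | zero => simp [orbitDeriv]
  | succ n ih => exact ih (f x) (Df x v)

/-- A bounded solution of `u (i + 1) = Df (f^[i] x) (u i) + w (i + 1)` on `{0, …, m}`: the stable
part of `w` is pushed forward from the past, the unstable part is pulled back from the future. -/
def windowSolution (f fInv : E → E) (Df DfInv P Q : E → E →L[ℝ] E) (m : ℕ) (x : E) (w : ℕ → E)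
    (i : ℕ) : E :=
  (∑ j ∈ Finset.range (i + 1), orbitDeriv f Df (i - j) (f^[j] x) (P (f^[j] x) (w j))) -
    ∑ j ∈ Finset.range (m - i),
      orbitDeriv fInv DfInv (j + 1) (f^[i + 1 + j] x) (Q (f^[i + 1 + j] x) (w (i + 1 + j)))

theorem windowSolution_sub (f fInv : E → E) (Df DfInv P Q : E → E →L[ℝ] E) (m : ℕ) (x : E)
    (w w' : ℕ → E) (i : ℕ) :
    windowSolution f fInv Df DfInv P Q m x (fun j => w j - w' j) i =
      windowSolution f fInv Df DfInv P Q m x w i -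
        windowSolution f fInv Df DfInv P Q m x w' i := by
  simp only [windowSolution, map_sub, Finset.sum_sub_distrib]
  abel

variable {f fInv : E → E} {Df DfInv P Q : E → E →L[ℝ] E}

theorem IsC1Diffeo.apply_inverse (hf : IsC1Diffeo f fInv Df DfInv) (x v : E) :
    Df x (DfInv (f x) v) = v := by
  obtain ⟨hl, hr, hd, hdi⟩ := hf
  have h1 : HasFDerivAt (f ∘ fInv) (Df x ∘L DfInv (f x)) (f x) := by
    refine HasFDerivAt.comp (f x) ?_ (hdi (f x))
    rw [hl x]
    exact hd x
  rw [hr.comp_eq_id] at h1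
  exact DFunLike.congr_fun (h1.unique (hasFDerivAt_id (f x))) v

theorem windowSolution_succ (hf : IsC1Diffeo f fInv Df DfInv)
    (hPQ : ∀ x, P x + Q x = ContinuousLinearMap.id ℝ E) {m i : ℕ} (hi : i < m) (x : E)
    (w : ℕ → E) :
    windowSolution f fInv Df DfInv P Q m x w (i + 1) =
      Df (f^[i] x) (windowSolution f fInv Df DfInv P Q m x w i) + w (i + 1) := by
  have hstable : ∀ j ∈ Finset.range (i + 1),
      orbitDeriv f Df (i + 1 - j) (f^[j] x) (P (f^[j] x) (w j)) =
        Df (f^[i] x) (orbitDeriv f Df (i - j) (f^[j] x) (P (f^[j] x) (w j))) := by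
    intro j hj
    have hji : j ≤ i := Nat.lt_succ_iff.mp (Finset.mem_range.mp hj)
    rw [Nat.succ_sub hji, Nat.succ_eq_add_one, orbitDeriv_succ_apply, ← Function.iterate_add_apply,
      Nat.sub_add_cancel hji]
  have hunstable : ∀ (j : ℕ) (v : E),
      Df (f^[i] x) (orbitDeriv fInv DfInv (j + 1) (f^[i + 1 + j] x) v) =
        orbitDeriv fInv DfInv j (f^[i + 1 + j] x) v := by
    intro j v
    rw [orbitDeriv_succ_apply, add_comm (i + 1) j, Function.iterate_add_apply,
      hf.1.iterate j (f^[i + 1] x), Function.iterate_succ_apply', hf.apply_inverse]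
  have hsplit : P (f^[i + 1] x) (w (i + 1)) = w (i + 1) - Q (f^[i + 1] x) (w (i + 1)) := by
    rw [eq_sub_iff_add_eq, ← _root_.add_apply, hPQ]
    rfl
  obtain ⟨l, rfl⟩ := Nat.exists_eq_add_of_lt hi
  have e1 : i + l + 1 - i = l + 1 := by omega
  have e2 : i + l + 1 - (i + 1) = l := by omega
  simp only [windowSolution, map_sub, map_sum, hunstable, e1, e2]
  rw [Finset.sum_range_succ _ (i + 1), Finset.sum_range_succ' _ l, Finset.sum_congr rfl hstable]
  have hshift : ∑ j ∈ Finset.range l, orbitDeriv fInv DfInv (j + 1) (f^[i + 1 + (j + 1)] x)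
        (Q (f^[i + 1 + (j + 1)] x) (w (i + 1 + (j + 1)))) =
      ∑ j ∈ Finset.range l, orbitDeriv fInv DfInv (j + 1) (f^[i + 1 + 1 + j] x)
        (Q (f^[i + 1 + 1 + j] x) (w (i + 1 + 1 + j))) :=
    Finset.sum_congr rfl fun j _ => by rw [add_right_comm (i + 1) 1 j, add_assoc (i + 1) j 1]
  rw [hshift]
  simp only [Nat.sub_self, orbitDeriv, ContinuousLinearMap.id_apply, add_zero, hsplit]
  abel

theorem sum_pow_le_inv_one_sub {a : ℝ} (ha : a ∈ Set.Ioo (0 : ℝ) 1) (s : Finset ℕ) :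
    ∑ j ∈ s, a ^ j ≤ (1 - a)⁻¹ :=
  (tsum_geometric_of_lt_one ha.1.le ha.2) ▸
    (summable_geometric_of_lt_one ha.1.le ha.2).sum_le_tsum s fun j _ => pow_nonneg ha.1.le j

theorem norm_windowSolution_le {C lam : ℝ} (hC : 0 < C) (hlam : lam ∈ Set.Ioo (0 : ℝ) 1)
    (hCL : IsGenCL f fInv Df DfInv C lam P Q) (m : ℕ) (x : E) {w : ℕ → E} {M : ℝ} (hM : 0 ≤ M)
    (hw : ∀ j, ‖w j‖ ≤ M) (i : ℕ) :
    ‖windowSolution f fInv Df DfInv P Q m x w i‖ ≤ 2 * C ^ 2 * (1 - lam)⁻¹ * M := by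
  obtain ⟨-, hP, hQ, -, -, hs, hu⟩ := hCL
  have hlam0 := hlam.1.le
  have hs' : ∀ j ∈ Finset.range (i + 1),
      ‖orbitDeriv f Df (i - j) (f^[j] x) (P (f^[j] x) (w j))‖ ≤ C ^ 2 * M * lam ^ (i - j) := by
    intro j _
    refine (hs _ _ _ ⟨_, rfl⟩).trans ?_
    have := ((P (f^[j] x)).le_of_opNorm_le (hP _) (w j)).trans
      (mul_le_mul_of_nonneg_left (hw j) hC.le)
    calc C * lam ^ (i - j) * ‖P (f^[j] x) (w j)‖ ≤ C * lam ^ (i - j) * (C * M) := by gcongr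
      _ = _ := by ring
  have hu' : ∀ j ∈ Finset.range (m - i),
      ‖orbitDeriv fInv DfInv (j + 1) (f^[i + 1 + j] x) (Q (f^[i + 1 + j] x) (w (i + 1 + j)))‖ ≤
        C ^ 2 * M * lam ^ j := by
    intro j _
    refine (hu _ _ _ ⟨_, rfl⟩).trans ?_
    have := ((Q (f^[i + 1 + j] x)).le_of_opNorm_le (hQ _) (w (i + 1 + j))).trans
      (mul_le_mul_of_nonneg_left (hw (i + 1 + j)) hC.le)
    have hpow : lam ^ (j + 1) ≤ lam ^ j := pow_le_pow_of_le_one hlam0 hlam.2.le (Nat.le_succ j)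
    calc C * lam ^ (j + 1) * ‖Q (f^[i + 1 + j] x) (w (i + 1 + j))‖
        ≤ C * lam ^ j * (C * M) := by gcongr
      _ = _ := by ring
  have hsum : ∑ j ∈ Finset.range (i + 1), C ^ 2 * M * lam ^ (i - j) ≤
      C ^ 2 * M * (1 - lam)⁻¹ := by
    rw [← Finset.mul_sum]
    have := Finset.sum_range_reflect (fun j => lam ^ j) (i + 1)
    simp only [Nat.add_sub_cancel] at this
    rw [this]
    exact mul_le_mul_of_nonneg_left (sum_pow_le_inv_one_sub hlam _) (by positivity)
  have hsum' : ∑ j ∈ Finset.range (m - i), C ^ 2 * M * lam ^ j ≤ C ^ 2 * M * (1 - lam)⁻¹ := by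
    rw [← Finset.mul_sum]
    exact mul_le_mul_of_nonneg_left (sum_pow_le_inv_one_sub hlam _) (by positivity)
  refine (norm_sub_le _ _).trans ?_
  linarith [norm_sum_le_of_le _ hs', norm_sum_le_of_le _ hu']

/-- An approximate right inverse of the difference operator along a cyclic pseudotrajectory `y`:
the average of the window solutions over all windows of length `m + 1` containing a point. -/
def averagedSolution (f fInv : E → E) (Df DfInv P Q : E → E →L[ℝ] E) (m : ℕ) {N : ℕ}
    (y w : ZMod N → E) (k : ZMod N) : E :=
  ((m : ℝ) + 1)⁻¹ • ∑ i ∈ Finset.range (m + 1),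
    windowSolution f fInv Df DfInv P Q m (y (k - i)) (fun j => w (k - i + j)) i

theorem averagedSolution_sub (f fInv : E → E) (Df DfInv P Q : E → E →L[ℝ] E) (m : ℕ) {N : ℕ}
    (y w w' : ZMod N → E) (k : ZMod N) :
    averagedSolution f fInv Df DfInv P Q m y (w - w') k =
      averagedSolution f fInv Df DfInv P Q m y w k -
        averagedSolution f fInv Df DfInv P Q m y w' k := by
  simp only [averagedSolution, Pi.sub_apply, windowSolution_sub, Finset.sum_sub_distrib, smul_sub]

theorem norm_averagedSolution_le {C lam : ℝ} (hC : 0 < C) (hlam : lam ∈ Set.Ioo (0 : ℝ) 1)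
    (hCL : IsGenCL f fInv Df DfInv C lam P Q) (m : ℕ) {N : ℕ} [NeZero N] (y w : ZMod N → E)
    (k : ZMod N) :
    ‖averagedSolution f fInv Df DfInv P Q m y w k‖ ≤ 2 * C ^ 2 * (1 - lam)⁻¹ * ‖w‖ := by
  have hm : (0 : ℝ) < m + 1 := by positivity
  have := norm_sum_le_of_le (Finset.range (m + 1)) fun i _ =>
    norm_windowSolution_le hC hlam hCL m (y (k - i)) (norm_nonneg w)
      (fun j => norm_le_pi_norm w (k - (i : ZMod N) + j)) i
  rw [averagedSolution, norm_smul, Real.norm_of_nonneg (inv_nonneg.2 hm.le), inv_mul_le_iff₀ hm]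
  simpa using this

theorem norm_averagedSolution_defect_le (hf : IsC1Diffeo f fInv Df DfInv) {C lam R δ : ℝ}
    (hC : 0 < C) (hlam : lam ∈ Set.Ioo (0 : ℝ) 1) (hCL : IsGenCL f fInv Df DfInv C lam P Q)
    (hR : ∀ x, ‖Df x‖ ≤ R) (hδ0 : 0 ≤ δ) (m : ℕ) {N : ℕ} [NeZero N] (y : ZMod N → E)
    (hδ : ∀ s : ZMod N, ∀ i < m, ‖Df (f^[i] (y s)) - Df (y (s + i))‖ ≤ δ) (w : ZMod N → E)
    (k : ZMod N) {L : ℝ} (hL : L = 2 * C ^ 2 * (1 - lam)⁻¹) :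
    ‖averagedSolution f fInv Df DfInv P Q m y w (k + 1) -
        Df (y k) (averagedSolution f fInv Df DfInv P Q m y w k) - w (k + 1)‖ ≤
      ((m + 1 : ℝ)⁻¹ * (L + R * L + 1) + δ * L) * ‖w‖ := by
  have hm : (0 : ℝ) < m + 1 := by positivity
  have hL0 : 0 ≤ L := by
    have : 0 < 1 - lam := by linarith [hlam.2]
    rw [hL]
    positivity
  set u : ZMod N → ℕ → E := fun s i =>
    windowSolution f fInv Df DfInv P Q m (y s) (fun j => w (s + j)) i with hu
  have hbound : ∀ s i, ‖u s i‖ ≤ L * ‖w‖ := fun s i => hL ▸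
    norm_windowSolution_le hC hlam hCL m (y s) (norm_nonneg w)
      (fun j => norm_le_pi_norm w (s + j)) i
  have hstep : ∀ i < m, u (k - i) (i + 1) =
      Df (f^[i] (y (k - i))) (u (k - i) i) + w (k + 1) := by
    intro i hi
    simp only [hu, windowSolution_succ hf hCL.1 hi]
    congr 2
    push_cast
    ring
  have key : averagedSolution f fInv Df DfInv P Q m y w (k + 1) -
        Df (y k) (averagedSolution f fInv Df DfInv P Q m y w k) - w (k + 1) =
      (m + 1 : ℝ)⁻¹ • (u (k + 1) 0 - Df (y k) (u (k - m) m) - w (k + 1) +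
        ∑ i ∈ Finset.range m, (Df (f^[i] (y (k - i))) - Df (y k)) (u (k - i) i)) := by
    have h1 : averagedSolution f fInv Df DfInv P Q m y w (k + 1) =
        (m + 1 : ℝ)⁻¹ • (∑ i ∈ Finset.range m, u (k - i) (i + 1) + u (k + 1) 0) := by
      rw [averagedSolution, Finset.sum_range_succ']
      simp only [hu, Nat.cast_add, Nat.cast_one, Nat.cast_zero, sub_zero,
        add_sub_add_right_eq_sub]
    have h2 : averagedSolution f fInv Df DfInv P Q m y w k =
        (m + 1 : ℝ)⁻¹ • (∑ i ∈ Finset.range m, u (k - i) i + u (k - m) m) := by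
      rw [averagedSolution, Finset.sum_range_succ]
    have h3 : w (k + 1) =
        (m + 1 : ℝ)⁻¹ • (∑ _i ∈ Finset.range m, w (k + 1) + w (k + 1)) := by
      rw [← Finset.sum_range_succ, Finset.sum_const, Finset.card_range,
        ← Nat.cast_smul_eq_nsmul ℝ, smul_smul]
      push_cast
      rw [inv_mul_cancel₀ hm.ne', one_smul]
    have h4 : ∑ i ∈ Finset.range m, u (k - i) (i + 1) =
        ∑ i ∈ Finset.range m, Df (f^[i] (y (k - i))) (u (k - i) i) +
          ∑ _i ∈ Finset.range m, w (k + 1) := by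
      rw [← Finset.sum_add_distrib]
      exact Finset.sum_congr rfl fun i hi => hstep i (Finset.mem_range.1 hi)
    conv_lhs => rw [h3]
    rw [h1, h2, h4, map_smul, ← smul_sub, ← smul_sub]
    simp only [map_add, map_sum, _root_.sub_apply, Finset.sum_sub_distrib]
    congr 1
    abel
  have hsum : ‖∑ i ∈ Finset.range m, (Df (f^[i] (y (k - i))) - Df (y k)) (u (k - i) i)‖ ≤
      m * (δ * (L * ‖w‖)) := by
    refine (norm_sum_le_of_le _ fun i hi => ?_).trans_eq
      (by rw [Finset.sum_const, Finset.card_range, nsmul_eq_mul])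
    have hi' := hδ (k - i) i (Finset.mem_range.1 hi)
    rw [sub_add_cancel] at hi'
    exact ContinuousLinearMap.le_of_opNorm_le_of_le _ hi' (hbound _ _)
  have hend : ‖Df (y k) (u (k - m) m)‖ ≤ R * (L * ‖w‖) :=
    ContinuousLinearMap.le_of_opNorm_le_of_le _ (hR _) (hbound _ _)
  rw [key, norm_smul, Real.norm_of_nonneg (inv_nonneg.2 hm.le), inv_mul_le_iff₀ hm]
  have hw := norm_le_pi_norm w (k + 1)
  have hδ1 : 0 ≤ δ * (L * ‖w‖) := by positivity
  refine (norm_add_le_of_le ((norm_sub_le _ _).trans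
    (add_le_add ((norm_sub_le _ _).trans (add_le_add (hbound _ _) hend)) hw)) hsum).trans ?_
  have hexpand : (m + 1 : ℝ) * (((m + 1 : ℝ)⁻¹ * (L + R * L + 1) + δ * L) * ‖w‖) =
      (L + R * L + 1) * ‖w‖ + (m + 1) * (δ * (L * ‖w‖)) := by
    field_simp
  rw [hexpand]
  linarith

/-- A map that differs from the identity by a contraction on a ball has a zero there as soon as its
value at the centre is small. -/
theorem exists_zero_of_near_id [CompleteSpace E] {G : E → E} {b : ℝ} (hb : 0 ≤ b)
    (hG : ∀ w w', ‖w‖ ≤ b → ‖w'‖ ≤ b → ‖G w - G w' - (w - w')‖ ≤ 1 / 2 * ‖w - w'‖)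
    (h0 : ‖G 0‖ ≤ b / 2) : ∃ w, ‖w‖ ≤ b ∧ G w = 0 := by
  have happ : ApproximatesLinearOn G (ContinuousLinearMap.id ℝ E) (Metric.closedBall 0 b)
      (1 / 2) := by
    intro w hw w' hw'
    simpa using hG w w' (by simpa using hw) (by simpa using hw')
  let inv : (ContinuousLinearMap.id ℝ E).NonlinearRightInverse :=
    ⟨id, 1, fun y => by simp, fun y => rfl⟩
  obtain ⟨w, hw, hw0⟩ := happ.surjOn_closedBall_of_nonlinearRightInverse inv hb subset_rfl
    (show (0 : E) ∈ _ by
      rw [Metric.mem_closedBall, dist_zero_left]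
      refine h0.trans_eq ?_
      norm_num [inv]
      ring)
  exact ⟨w, by simpa using hw, hw0⟩

theorem norm_sub_iterate_le {F : Type*} [NormedAddCommGroup F] {g : F → F}
    {R d : ℝ} (hR : 0 ≤ R) (hlip : ∀ x x', ‖g x - g x'‖ ≤ R * ‖x - x'‖)
    {N : ℕ} {y : ZMod N → F} (hd : 0 ≤ d) (hy : ∀ k, ‖y (k + 1) - g (y k)‖ ≤ d) (s : ZMod N)
    (i : ℕ) : ‖g^[i] (y s) - y (s + i)‖ ≤ d * (R + 1) ^ i := by
  induction i with
  | zero => simpa using hd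
  | succ i ih =>
    rw [Function.iterate_succ_apply', Nat.cast_succ, ← add_assoc]
    have h1 := (hlip (g^[i] (y s)) (y (s + i))).trans (mul_le_mul_of_nonneg_left ih hR)
    have h2 := hy (s + i)
    rw [norm_sub_rev] at h2
    have h3 := norm_sub_le_norm_sub_add_norm_sub (g (g^[i] (y s))) (g (y (s + i))) (y (s + i + 1))
    have h4 : d * 1 ≤ d * (R + 1) ^ i :=
      mul_le_mul_of_nonneg_left (one_le_pow₀ (by linarith)) hd
    rw [pow_succ]
    linarith

/-- Cyclic pseudotrajectories with sufficiently small jumps are shadowed by periodic orbits. -/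
theorem exists_cyclic_shadowing [CompleteSpace E] {R : ℝ} {r : ℝ → ℝ}
    (hf : IsC1Diffeo f fInv Df DfInv) (hreg : C1Reg f Df DfInv R r) {C lam : ℝ} (hC : 0 < C)
    (hlam : lam ∈ Set.Ioo (0 : ℝ) 1) (hCL : IsGenCL f fInv Df DfInv C lam P Q) {ε : ℝ}
    (hε : 0 < ε) :
    ∃ d > 0, ∀ (N : ℕ) [NeZero N] (y : ZMod N → E), (∀ k, ‖y (k + 1) - f (y k)‖ ≤ d) →
      ∃ z : ZMod N → E, (∀ k, z (k + 1) = f (z k)) ∧ ∀ k, ‖y k - z k‖ < ε := by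
  obtain ⟨hR, hmono, -, hlim, -, hDf, -, hcont⟩ := hreg
  have hlip : ∀ x x', ‖f x - f x'‖ ≤ R * ‖x - x'‖ := fun x x' =>
    convex_univ.norm_image_sub_le_of_norm_hasFDerivWithin_le
      (fun z _ => (hf.2.2.1 z).hasFDerivWithinAt) (fun z _ => hDf z) (mem_univ x') (mem_univ x)
  obtain ⟨L, hL⟩ : ∃ L, L = 2 * C ^ 2 * (1 - lam)⁻¹ := ⟨_, rfl⟩
  have hL0 : 0 < L := by
    have : 0 < 1 - lam := by linarith [hlam.2]
    rw [hL]
    positivity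
  obtain ⟨m, hm⟩ := exists_nat_gt (8 * (L + R * L + 1))
  have hm' : (m + 1 : ℝ)⁻¹ * (L + R * L + 1) ≤ 1 / 8 := by
    rw [inv_mul_le_iff₀ (by positivity)]
    linarith
  obtain ⟨ρ, hρ, hρε, hrρ⟩ : ∃ ρ, 0 < ρ ∧ ρ < ε ∧ r ρ < 1 / (8 * L) := by
    have h1 := hlim.eventually (gt_mem_nhds (show (0 : ℝ) < 1 / (8 * L) by positivity))
    have h2 : ∀ᶠ z in nhdsWithin (0 : ℝ) (Set.Ioi 0), z ∈ Set.Ioo 0 ε := Ioo_mem_nhdsGT hε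
    obtain ⟨ρ, h, h'⟩ := (h1.and h2).exists
    exact ⟨ρ, h'.1, h'.2, h⟩
  have hr : ∀ v : E, ‖v‖ ≤ ρ → r ‖v‖ ≤ 1 / (8 * L) := fun v hv =>
    (hmono (norm_nonneg v) hρ.le hv).trans hrρ.le
  have hrL : 1 / (8 * L) * L = 1 / 8 := by field_simp
  refine ⟨min (ρ / L / 2) (ρ / (R + 1) ^ m), by positivity, fun N _ y hy => ?_⟩
  have hd0 : 0 ≤ min (ρ / L / 2) (ρ / (R + 1) ^ m) := by positivity
  have hδ : ∀ s : ZMod N, ∀ i < m, ‖Df (f^[i] (y s)) - Df (y (s + i))‖ ≤ 1 / (8 * L) := by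
    intro s i hi
    have h1 : ‖f^[i] (y s) - y (s + i)‖ ≤ ρ := by
      refine (norm_sub_iterate_le hR.le hlip hd0 hy s i).trans ?_
      calc _ ≤ ρ / (R + 1) ^ m * (R + 1) ^ m := by
            gcongr
            · exact min_le_right _ _
            · linarith
        _ = ρ := by field_simp
    have h2 := hcont (y (s + i)) (f^[i] (y s) - y (s + i))
    rw [add_sub_cancel] at h2
    exact h2.trans (hr _ h1)
  set T : (ZMod N → E) → ZMod N → E := averagedSolution f fInv Df DfInv P Q m y with hT
  have hTsub : ∀ w w' k, T (w - w') k = T w k - T w' k := averagedSolution_sub _ _ _ _ _ _ m y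
  have hTle : ∀ w k, ‖T w k‖ ≤ L * ‖w‖ := fun w k =>
    hL ▸ norm_averagedSolution_le hC hlam hCL m y w k
  have hT0 : T 0 = 0 := funext fun k => by simpa using hTle 0 k
  have hTρ : ∀ w, ‖w‖ ≤ ρ / L → ∀ k, ‖T w k‖ ≤ ρ := fun w hw k =>
    (hTle w k).trans (by rwa [le_div_iff₀' hL0] at hw)
  let G : (ZMod N → E) → ZMod N → E := fun w k => y k + T w k - f (y (k - 1) + T w (k - 1))
  obtain ⟨w, hw, hGw⟩ : ∃ w, ‖w‖ ≤ ρ / L ∧ G w = 0 := by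
    refine exists_zero_of_near_id (by positivity) (fun w w' hw hw' => ?_) ?_
    · refine (pi_norm_le_iff_of_nonneg (by positivity)).2 fun k => ?_
      obtain ⟨k, rfl⟩ : ∃ l, l + 1 = k := ⟨k - 1, by ring⟩
      have h1 := norm_averagedSolution_defect_le hf hC hlam hCL hDf (by positivity) m y hδ
        (w - w') k hL
      rw [← hT, hTsub, hTsub, map_sub] at h1
      have h2 : ‖f (y k + T w k) - f (y k + T w' k) - Df (y k) (T w k - T w' k)‖ ≤
          1 / (8 * L) * ‖T w k - T w' k‖ := by
        have := (convex_closedBall (y k) ρ).norm_image_sub_le_of_norm_hasFDerivWithin_le'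
          (f := f) (f' := Df) (φ := Df (y k)) (C := 1 / (8 * L)) (x := y k + T w' k)
          (y := y k + T w k) (fun z _ => (hf.2.2.1 z).hasFDerivWithinAt) (fun z hz => ?_)
          (by simpa using hTρ w' hw' k) (by simpa using hTρ w hw k)
        · simpa using this
        · have h := hcont (y k) (z - y k)
          rw [add_sub_cancel] at h
          exact h.trans (hr _ (by simpa [dist_eq_norm] using hz))
      have h3 : 1 / (8 * L) * ‖T w k - T w' k‖ ≤ 1 / 8 * ‖w - w'‖ := by
        rw [← hTsub, ← hrL, mul_assoc]
        exact mul_le_mul_of_nonneg_left (hTle _ k) (by positivity)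
      have h4 : (G w - G w' - (w - w')) (k + 1) =
          (T w (k + 1) - T w' (k + 1) - (Df (y k) (T w k) - Df (y k) (T w' k)) -
            (w - w') (k + 1)) -
          (f (y k + T w k) - f (y k + T w' k) - Df (y k) (T w k - T w' k)) := by
        simp only [G, Pi.sub_apply, add_sub_cancel_right, map_sub]
        abel
      have h5 : ((m + 1 : ℝ)⁻¹ * (L + R * L + 1) + 1 / (8 * L) * L) * ‖w - w'‖ ≤
          (1 / 8 + 1 / 8) * ‖w - w'‖ := by
        rw [hrL]
        gcongr
      rw [h4]
      refine (norm_sub_le _ _).trans ?_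
      linarith [norm_nonneg (w - w')]
    · refine (pi_norm_le_iff_of_nonneg (by positivity)).2 fun k => ?_
      have := hy (k - 1)
      rw [sub_add_cancel] at this
      simpa [G, hT0] using this.trans (min_le_left _ _)
  refine ⟨fun k => y k + T w k, fun k => ?_, fun k => ?_⟩
  · simpa [G, sub_eq_zero] using congrFun hGw (k + 1)
  · simpa using (hTρ w hw k).trans_lt hρε

theorem norm_val_succ_sub_le_of_closed {F : Type*} [NormedAddCommGroup F] {g : F → F}
    {N : ℕ} [NeZero N] {d : ℝ} {y : ℕ → F} (hclosed : y N = y 0)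
    (hy : ∀ k < N, ‖y (k + 1) - g (y k)‖ ≤ d) (k : ZMod N) :
    ‖y (k + 1).val - g (y k.val)‖ ≤ d := by
  have hk := hy k.val k.val_lt
  have hcast : k + 1 = ((k.val + 1 : ℕ) : ZMod N) := by simp
  rcases (Nat.succ_le_of_lt k.val_lt).lt_or_eq with h | h
  · rwa [hcast, ZMod.val_cast_of_lt h]
  · have h0 : (k + 1).val = 0 := by
      rw [hcast, show k.val + 1 = N from h, ZMod.natCast_self, ZMod.val_zero]
    have hN : y (k.val + 1) = y 0 := (congrArg y h).trans hclosed
    rwa [h0, ← hN]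

end Shadowing

/-- For a `C¹` diffeomorphism of a reflexive Banach space satisfying
the `C¹` regularity conditions and a generalized `(C, λ)`-structure, periodic points are
dense in the chain-recurrent set. -/
theorem statement12
    {B : Type*} [NormedAddCommGroup B] [NormedSpace ℝ B] [CompleteSpace B]
    (hrefl : Function.Surjective (NormedSpace.inclusionInDoubleDual ℝ B))
    (f fInv : B → B) (Df DfInv : B → B →L[ℝ] B) (R : ℝ) (r : ℝ → ℝ)
    (hf : IsC1Diffeo f fInv Df DfInv) (hreg : C1Reg f Df DfInv R r)
    (C lam : ℝ) (hC : 0 < C) (hlam : lam ∈ Set.Ioo (0 : ℝ) 1)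
    (P Q : B → B →L[ℝ] B) (hCL : IsGenCL f fInv Df DfInv C lam P Q) :
    ∀ x : B, ChainRecurrentPt f x →
      ∀ ε : ℝ, 0 < ε → ∃ (p : B) (N : ℕ), 0 < N ∧ f^[N] p = p ∧ ‖x - p‖ < ε := by
  intro x hx ε hε
  obtain ⟨d, hd, hshadow⟩ := exists_cyclic_shadowing hf hreg hC hlam hCL hε
  obtain ⟨N, hN, y, hy0, hyN, hy⟩ := hx d hd
  have : NeZero N := ⟨hN.ne'⟩
  obtain ⟨z, hz, hyz⟩ := hshadow N (fun k => y k.val)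
    (norm_val_succ_sub_le_of_closed (hyN.trans hy0.symm) hy)
  have hiter : ∀ n : ℕ, f^[n] (z 0) = z n := by
    intro n
    induction n with
    | zero => simp
    | succ n ih => rw [Function.iterate_succ_apply', ih, Nat.cast_succ, hz]
  refine ⟨z 0, N, hN, by rw [hiter, ZMod.natCast_self], ?_⟩
  simpa [hy0] using hyz 0

end
end
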